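/- arXiv:1505.06439 — 2 statements merged into one kernel-verified Lean document; each statement's English description precedes it below -/
import Mathlib

section
/- Let Ω ⊆ ℝ² be a nonempty bounded open simply connected set, and let γ : [0,1] → ℝ² be a continuous injective map such that γ(t) ∈ Ω for all t ∈ (0,1) and γ(0), γ(1) belong to the frontier of Ω. Then the open set Ω \ γ((0,1)) has exactly two connected components, and each of these components is an open simply connected subset of ℝ². -/
open Set

namespace Crosscut

open Complex Metric Topology Filter
open scoped Real

/-- A continuous function whose exponential is `1` is `2πi` times a continuous integer. -/
lemma exists_int_of_exp_eq_one {X : Type*} [TopologicalSpace X] {S : Set X} {h : X → ℂ}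
    (hc : ContinuousOn h S) (he : ∀ z ∈ S, exp (h z) = 1) :
    ∃ k : X → ℤ, ContinuousOn k S ∧ ∀ z ∈ S, h z = k z * (2 * π * I) := by
  have H : ∀ z ∈ S, ∃ n : ℤ, h z = n * (2 * π * I) := fun z hz ↦ exp_eq_one_iff.mp (he z hz)
  choose! k hk using H
  refine ⟨k, ?_, hk⟩
  rw [Int.isClosedEmbedding_coe_real.isInducing.continuousOn_iff]
  have : ContinuousOn (fun z ↦ (h z / (2 * π * I)).re) S :=
    continuous_re.comp_continuousOn (hc.div_const _)
  refine this.congr fun z hz ↦ ?_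
  simp [hk z hz, mul_div_cancel_right₀ _ two_pi_I_ne_zero]

/-- Two continuous logarithms of the same function on a preconnected set differ by a constant. -/
lemma sub_eq_sub_of_exp_eq {X : Type*} [TopologicalSpace X] {S : Set X} {f g : X → ℂ}
    (hS : IsPreconnected S) (hf : ContinuousOn f S) (hg : ContinuousOn g S)
    (he : ∀ z ∈ S, exp (f z) = exp (g z)) {x y : X} (hx : x ∈ S) (hy : y ∈ S) :
    f x - g x = f y - g y := by
  obtain ⟨k, hk, hk'⟩ := exists_int_of_exp_eq_one (hf.sub hg)
    (fun z hz ↦ by simp [Complex.exp_sub, he z hz])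
  have := hS.constant hk hx hy
  rw [show f x - g x = _ from hk' x hx, show f y - g y = _ from hk' y hy, this]

/-- Moving the center of `z ↦ z - p` along a path which avoids `U` does not change the
homotopy class of this function on `U`. -/
lemma exists_exp_of_joinedIn {U : Set ℂ} {p q : ℂ} (h : JoinedIn Uᶜ p q) :
    ∃ f : ℂ → ℂ, ContinuousOn f U ∧ ∀ z ∈ U, z - p = (z - q) * exp (f z) := by
  classical
  obtain ⟨γ, hγ⟩ := h.symm
  have hne : ∀ (z : U) (t : unitInterval), (z : ℂ) - γ t ≠ 0 := fun z t e ↦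
    hγ t (by rw [← sub_eq_zero.mp e]; exact z.2)
  let H : C(unitInterval × U, {z : ℂ // z ≠ 0}) :=
    ⟨fun x ↦ ⟨((x.2 : ℂ) - γ x.1) / (x.2 - γ 0), div_ne_zero (hne _ _) (hne _ _)⟩, by
      refine Continuous.subtype_mk (Continuous.div ?_ ?_ fun x ↦ hne _ _) _ <;> fun_prop⟩
  have hH : ∀ a, H (0, a) = ⟨exp (ContinuousMap.const U (0 : ℂ) a), exp_ne_zero _⟩ := fun a ↦
    Subtype.ext (by simpa [H] using by simpa using hne a 0)
  let L := isCoveringMap_exp.liftHomotopy H (ContinuousMap.const U 0) hH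
  have hL : ∀ z : U, exp (L (1, z)) = ((z : ℂ) - p) / (z - q) := fun z ↦ by
    have := congrArg Subtype.val (congrFun (isCoveringMap_exp.liftHomotopy_lifts H
      (ContinuousMap.const U 0) hH) (1, z))
    exact this.trans (by simp [H])
  refine ⟨fun z ↦ if hz : z ∈ U then L (1, ⟨z, hz⟩) else 0, ?_, fun z hz ↦ ?_⟩
  · rw [continuousOn_iff_continuous_domRestrict]
    have : Continuous fun z : U ↦ L (1, z) := by fun_prop
    convert! this using 2 with z
    simp
  · have := hne ⟨z, hz⟩ 0
    simp only [Path.source] at this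
    simp only [hz, dite_true]
    rw [hL ⟨z, hz⟩, mul_div_cancel₀ _ this]

/-- A nonzero power of `z - c` has no continuous logarithm on a circle centered at `c`. -/
lemma no_log_on_sphere {c : ℂ} {r : ℝ} (hr : 0 < r) {n : ℤ} {h : ℂ → ℂ}
    (hc : ContinuousOn h (sphere c r)) (he : ∀ z ∈ sphere c r, exp (h z) = (z - c) ^ n) :
    n = 0 := by
  have hmem : ∀ θ : ℝ, circleMap c r θ ∈ sphere c r := circleMap_mem_sphere c hr.le
  have h1 : ContinuousOn (fun θ : ℝ ↦ h (circleMap c r θ)) univ :=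
    hc.comp (continuous_circleMap c r).continuousOn fun θ _ ↦ hmem θ
  have h2 : ContinuousOn (fun θ : ℝ ↦ (n : ℂ) * (Real.log r + θ * I)) univ := by fun_prop
  have key := sub_eq_sub_of_exp_eq isPreconnected_univ h1 h2 (fun θ _ ↦ by
    rw [he _ (hmem θ), Complex.exp_int_mul, Complex.exp_add, ← Complex.ofReal_exp,
      Real.exp_log hr]
    simp [circleMap]) (mem_univ 0) (mem_univ (2 * π))
  have h3 : circleMap c r (2 * π) = circleMap c r 0 := by simp [circleMap]
  rw [h3] at key
  have : (n : ℂ) * (2 * π * I) = 0 := by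
    push_cast at key
    linear_combination key
  simpa [two_pi_I_ne_zero] using this

/-- Multiplication by a cutoff extends a function continuously by zero. -/
lemma continuousOn_cutoff_mul {X : Type*} [TopologicalSpace X] {S W : Set X} {κ f : X → ℂ}
    (hW : IsOpen W) (hκ : ContinuousOn κ S) (hf : ContinuousOn f (S ∩ W))
    (h0 : ∀ z ∈ S, z ∉ W → κ =ᶠ[𝓝 z] 0) : ContinuousOn (fun z ↦ κ z * f z) S := by
  intro z hz
  by_cases hzW : z ∈ W
  · have := ((hκ.mono inter_subset_left).mul hf) z ⟨hz, hzW⟩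
    rwa [continuousWithinAt_inter (hW.mem_nhds hzW)] at this
  · have h1 : (fun z ↦ κ z * f z) =ᶠ[𝓝 z] fun _ ↦ 0 := by
      filter_upwards [h0 z hz hzW] with w hw
      simp [hw]
    exact (continuousAt_const.congr h1.symm).continuousWithinAt

/-- A nonvanishing function on a punctured disc is a power of `z - c` times an exponential. -/
lemma exists_zpow_mul_exp_ball {c : ℂ} {r : ℝ} (hr : 0 < r) {F : ℂ → ℂ}
    (hF : ContinuousOn F (ball c r \ {c})) (h0 : ∀ z ∈ ball c r \ {c}, F z ≠ 0) :
    ∃ (n : ℤ) (g : ℂ → ℂ), ContinuousOn g (ball c r \ {c}) ∧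
      ∀ z ∈ ball c r \ {c}, F z = (z - c) ^ n * exp (g z) := by
  classical
  set S : Set ℂ := {ζ | ζ.re < Real.log r} with hS
  have hSo : IsOpen S := isOpen_lt continuous_re continuous_const
  have hSc : Convex ℝ S := convex_halfSpace_re_lt _
  have hSne : S.Nonempty := ⟨((Real.log r - 1 : ℝ) : ℂ), by simp [hS]⟩
  have hSsc : IsSimplyConnected S :=
    haveI := hSc.contractibleSpace hSne
    SimplyConnectedSpace.ofContractible _
  have hmaps : MapsTo (fun ζ ↦ c + exp ζ) S (ball c r \ {c}) := by
    intro ζ hζ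
    refine ⟨?_, by simp [exp_ne_zero]⟩
    simp only [mem_ball, dist_eq_norm, add_sub_cancel_left, norm_exp]
    exact (Real.lt_log_iff_exp_lt hr).mp hζ
  obtain ⟨φ, hφ, hφe⟩ := exists_continuousOn_eqOn_exp_comp hSsc hSo
    (g := fun ζ ↦ F (c + exp ζ)) (hF.comp (by fun_prop) hmaps)
    (by rintro ⟨ζ, hζ, h⟩; exact h0 _ (hmaps hζ) h)
  have hshift : ∀ ζ, ζ + 2 * π * I ∈ S ↔ ζ ∈ S := fun ζ ↦ by simp [hS]
  obtain ⟨k, hk, hk'⟩ := exists_int_of_exp_eq_one (S := S)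
    (h := fun ζ ↦ φ (ζ + 2 * π * I) - φ ζ)
    ((hφ.comp (by fun_prop) fun ζ hζ ↦ (hshift ζ).2 hζ).sub hφ) (fun ζ hζ ↦ by
      have h1 : exp (φ (ζ + 2 * π * I)) = F (c + exp (ζ + 2 * π * I)) :=
        hφe ((hshift ζ).2 hζ)
      have h2 : exp (φ ζ) = F (c + exp ζ) := hφe hζ
      rw [Complex.exp_sub, h1, h2, exp_periodic ζ]
      exact div_self (h0 _ (hmaps hζ)))
  obtain ⟨ζ₀, hζ₀⟩ := hSne
  set n := k ζ₀ with hn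
  have hkn : ∀ ζ ∈ S, k ζ = n := fun ζ hζ ↦ hSc.isPreconnected.constant hk hζ hζ₀
  set ψ : ℂ → ℂ := fun ζ ↦ if ζ ∈ S then φ ζ - n * ζ else 0 with hψ
  have hper : Function.Periodic ψ (2 * π * I) := by
    intro ζ
    by_cases hζ : ζ ∈ S
    · have := hk' ζ hζ
      rw [hkn ζ hζ] at this
      simp only [hψ, hζ, hshift, if_true]
      linear_combination this
    · simp [hψ, hζ, hshift]
  set g : ℂ → ℂ := fun z ↦ ψ (log (z - c)) with hg
  have hgψ : ∀ ζ, g (c + exp ζ) = ψ ζ := by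
    intro ζ
    obtain ⟨m, hm⟩ := exp_eq_exp_iff_exists_int.mp (exp_log (exp_ne_zero ζ))
    simp only [hg, add_sub_cancel_left, hm]
    simpa using hper.zsmul m ζ
  have hlogS : ∀ z ∈ ball c r \ {c}, log (z - c) ∈ S := by
    rintro z ⟨hz, hzc⟩
    have h1 : 0 < ‖z - c‖ := by simpa [sub_eq_zero] using hzc
    simpa [hS, log_re] using Real.log_lt_log h1 (by simpa [dist_eq_norm] using hz)
  refine ⟨n, g, ?_, ?_⟩
  · intro z hz
    refine ContinuousAt.continuousWithinAt ?_
    have hzc : z - c ≠ 0 := by simpa [sub_eq_zero] using hz.2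
    set ζ := log (z - c) with hζ
    have hzeq : c + exp ζ = z := by rw [hζ, exp_log hzc]; ring
    have hmap : map (fun ζ ↦ c + exp ζ) (𝓝 ζ) = 𝓝 z := by
      have : HasStrictDerivAt (fun ζ ↦ c + exp ζ) (exp ζ) ζ :=
        (hasStrictDerivAt_exp ζ).const_add c
      rw [this.map_nhds_eq (exp_ne_zero _), hzeq]
    rw [ContinuousAt, ← hmap, tendsto_map'_iff]
    have h1 : (g ∘ fun ζ ↦ c + exp ζ) = ψ := funext hgψ
    rw [h1, ← hzeq, hgψ]
    have h2 : ContinuousAt (fun ζ ↦ φ ζ - n * ζ) ζ :=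
      (hφ.continuousAt (hSo.mem_nhds (hlogS z hz))).sub (by fun_prop)
    refine h2.congr ?_
    filter_upwards [hSo.mem_nhds (hlogS z hz)] with w hw
    simp [hψ, hw]
  · intro z hz
    have hzc : z - c ≠ 0 := by simpa [sub_eq_zero] using hz.2
    have hzS := hlogS z hz
    have h1 : exp (φ (log (z - c))) = F (c + exp (log (z - c))) := hφe hzS
    rw [exp_log hzc, add_sub_cancel] at h1
    simp only [hg, hψ, hzS, if_true]
    rw [Complex.exp_sub, h1, Complex.exp_int_mul, exp_log hzc]
    field_simp

/-- A nonvanishing function on a punctured simply connected domain is a power of `z - c` times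
an exponential. -/
lemma exists_zpow_mul_exp {Ω : Set ℂ} (hΩo : IsOpen Ω) (hΩ : IsSimplyConnected Ω) {c : ℂ}
    (hc : c ∈ Ω) {F : ℂ → ℂ} (hF : ContinuousOn F (Ω \ {c})) (h0 : ∀ z ∈ Ω \ {c}, F z ≠ 0) :
    ∃ (n : ℤ) (g : ℂ → ℂ), ContinuousOn g (Ω \ {c}) ∧
      ∀ z ∈ Ω \ {c}, F z = (z - c) ^ n * exp (g z) := by
  classical
  obtain ⟨r, hr, hball⟩ := Metric.isOpen_iff.mp hΩo c hc
  have hsub : ball c r \ {c} ⊆ Ω \ {c} := sdiff_subset_sdiff_left hball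
  obtain ⟨n, g, hg, hFg⟩ := exists_zpow_mul_exp_ball hr (hF.mono hsub)
    fun z hz ↦ h0 z (hsub hz)
  set κ : ℂ → ℂ := fun z ↦ ((max 0 (min 1 (2 - 4 * dist z c / r)) : ℝ) : ℂ) with hκ
  have hκc : Continuous κ := by
    rw [hκ]; fun_prop
  have hκ1 : ∀ z ∈ ball c (r / 4), κ z = 1 := by
    intro z hz
    have : 4 * dist z c / r ≤ 1 := by
      rw [div_le_one hr]; have := mem_ball.mp hz; linarith
    have h2 : min 1 (2 - 4 * dist z c / r) = 1 := min_eq_left (by linarith)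
    simp [hκ, h2]
  have hκ0 : ∀ z, r / 2 < dist z c → κ z = 0 := by
    intro z hz
    have : 2 ≤ 4 * dist z c / r := by
      rw [le_div_iff₀ hr]; linarith
    have h2 : max 0 (min 1 (2 - 4 * dist z c / r)) = 0 :=
      max_eq_left ((min_le_right _ _).trans (by linarith))
    simp [hκ, h2]
  have hκg : ContinuousOn (fun z ↦ κ z * g z) (Ω \ {c}) := by
    refine continuousOn_cutoff_mul (W := ball c r) isOpen_ball hκc.continuousOn
      (hg.mono fun z hz ↦ ⟨hz.2, hz.1.2⟩) fun z _ hz ↦ ?_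
    have hz' : r / 2 < dist z c := by
      have : r ≤ dist z c := by simpa using hz
      linarith
    filter_upwards [(isOpen_lt continuous_const (continuous_id.dist continuous_const)).mem_nhds
      hz'] with w hw
    exact hκ0 w hw
  set G : ℂ → ℂ := fun z ↦ if z = c then 1 else F z * (z - c) ^ (-n) * exp (-(κ z * g z)) with hG
  have hGc : ContinuousOn G Ω := by
    intro z hz
    by_cases hzc : z = c
    · subst hzc
      refine ContinuousAt.continuousWithinAt (continuousAt_const (y := (1 : ℂ)) |>.congr ?_)
      filter_upwards [ball_mem_nhds z (show (0 : ℝ) < r / 4 by linarith)] with w hw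
      by_cases hwz : w = z
      · simp [hG, hwz]
      · have hwr : w ∈ ball z r \ {z} := ⟨ball_subset_ball (by linarith) hw, hwz⟩
        have hne : w - z ≠ 0 := sub_ne_zero.mpr hwz
        simp only [hG, hwz, if_false, hκ1 w hw, hFg w hwr, one_mul, Complex.exp_neg, zpow_neg]
        field_simp
    · have h1 : ContinuousOn (fun z ↦ F z * (z - c) ^ (-n) * exp (-(κ z * g z))) (Ω \ {c}) := by
        refine (hF.mul ?_).mul hκg.neg.cexp
        exact (continuousOn_id.sub continuousOn_const).zpow₀ _
          fun z hz ↦ Or.inl (sub_ne_zero.mpr hz.2)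
      have h2 := h1.continuousAt ((hΩo.sdiff isClosed_singleton).mem_nhds ⟨hz, hzc⟩)
      refine (h2.congr ?_).continuousWithinAt
      filter_upwards [isOpen_ne.mem_nhds hzc] with w hw
      simp [hG, hw]
  obtain ⟨h, hh, hhe⟩ := exists_continuousOn_eqOn_exp_comp hΩ hΩo hGc (by
    rintro ⟨z, hz, h⟩
    by_cases hzc : z = c
    · simp [hG, hzc] at h
    · have h2 := h0 z ⟨hz, hzc⟩
      simp [hG, hzc, exp_ne_zero, h2, zpow_ne_zero, sub_ne_zero] at h)
  refine ⟨n, fun z ↦ h z + κ z * g z, (hh.mono sdiff_subset).add hκg, fun z hz ↦ ?_⟩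
  have h1 : exp (h z) = G z := hhe hz.1
  have hzc : z ≠ c := hz.2
  have hne : z - c ≠ 0 := sub_ne_zero.mpr hz.2
  rw [Complex.exp_add, h1]
  simp only [hG, hzc, if_false, Complex.exp_neg, zpow_neg]
  have := exp_ne_zero (κ z * g z)
  field_simp

/-- The Mayer-Vietoris argument: an integer-valued function on the complement of two closed sets
which meet in a single point `c` is the difference of two logarithms of a power of `z - c`, each
defined off one of the closed sets. -/
lemma exists_log_sub_log {Ω : Set ℂ} (hΩo : IsOpen Ω) (hΩ : IsSimplyConnected Ω) {c : ℂ}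
    (hc : c ∈ Ω) {K₁ K₂ : Set ℂ} (hK₁ : IsClosed K₁) (hK₂ : IsClosed K₂) (hc₁ : c ∈ K₁)
    (hc₂ : c ∈ K₂) (hK : K₁ ∩ K₂ ⊆ {c}) {f : ℂ → ℤ} (hf : ContinuousOn f (Ω \ (K₁ ∪ K₂))) :
    ∃ (n : ℤ) (h₁ h₂ : ℂ → ℂ), ContinuousOn h₁ (Ω \ K₁) ∧ ContinuousOn h₂ (Ω \ K₂) ∧
      (∀ z ∈ Ω \ K₁, exp (h₁ z) = (z - c) ^ n) ∧ (∀ z ∈ Ω \ K₂, exp (h₂ z) = (z - c) ^ n) ∧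
      ∀ z, h₁ z - h₂ z = f z * (2 * π * I) := by
  set ρ : ℂ → ℂ := fun z ↦
    ((max 0 (min 1 (3 * infDist z K₂ / (infDist z K₁ + infDist z K₂) - 1)) : ℝ) : ℂ) with hρ
  have hpos₁ : ∀ z, z ∉ K₁ → 0 < infDist z K₁ := fun z hz ↦
    (hK₁.notMem_iff_infDist_pos ⟨c, hc₁⟩).mp hz
  have hpos₂ : ∀ z, z ∉ K₂ → 0 < infDist z K₂ := fun z hz ↦
    (hK₂.notMem_iff_infDist_pos ⟨c, hc₂⟩).mp hz
  have hpos : ∀ z ∈ ({c}ᶜ : Set ℂ), 0 < infDist z K₁ + infDist z K₂ := by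
    intro z hz
    by_cases hz1 : z ∈ K₁
    · have := hpos₂ z fun h2 ↦ hz (hK ⟨hz1, h2⟩)
      have := infDist_nonneg (x := z) (s := K₁); linarith
    · have := hpos₁ z hz1
      have := infDist_nonneg (x := z) (s := K₂); linarith
  have hqc : ContinuousOn (fun z ↦ 3 * infDist z K₂ / (infDist z K₁ + infDist z K₂) - 1)
      ({c}ᶜ : Set ℂ) := by
    refine ContinuousOn.sub (ContinuousOn.div ?_ ?_ fun z hz ↦ (hpos z hz).ne') continuousOn_const
    · exact (continuous_const.mul (continuous_infDist_pt _)).continuousOn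
    · exact ((continuous_infDist_pt _).add (continuous_infDist_pt _)).continuousOn
  have hρc : ContinuousOn ρ ({c}ᶜ : Set ℂ) :=
    continuous_ofReal.comp_continuousOn
      ((continuous_const.max (continuous_const.min continuous_id)).comp_continuousOn hqc)
  have hq : ∀ z ∈ ({c}ᶜ : Set ℂ),
      ContinuousAt (fun z ↦ 3 * infDist z K₂ / (infDist z K₁ + infDist z K₂) - 1) z :=
    fun z hz ↦ hqc.continuousAt (isOpen_compl_singleton.mem_nhds hz)
  have hsub₁ : Ω \ K₁ ⊆ {c}ᶜ := fun z hz h ↦ hz.2 (h ▸ hc₁)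
  have hsub₂ : Ω \ K₂ ⊆ {c}ᶜ := fun z hz h ↦ hz.2 (h ▸ hc₂)
  have hfc : ContinuousOn (fun z ↦ (f z : ℂ)) (Ω \ (K₁ ∪ K₂)) :=
    (continuous_of_discreteTopology (f := fun k : ℤ ↦ (k : ℂ))).comp_continuousOn hf
  have hf₁ : ContinuousOn (fun z ↦ ρ z * f z) (Ω \ K₁) := by
    refine continuousOn_cutoff_mul hK₂.isOpen_compl (hρc.mono hsub₁)
      (hfc.mono fun z hz ↦ ⟨hz.1.1, by simpa using ⟨hz.1.2, hz.2⟩⟩) fun z hz hz2 ↦ ?_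
    have hz2 : z ∈ K₂ := by simpa using hz2
    have hneg : 3 * infDist z K₂ / (infDist z K₁ + infDist z K₂) - 1 < 0 := by
      simp [infDist_zero_of_mem hz2]
    filter_upwards [(hq z (hsub₁ hz)).eventually_lt continuousAt_const hneg] with w hw
    simp [hρ, max_eq_left ((min_le_right _ _).trans hw.le)]
  have hf₂ : ContinuousOn (fun z ↦ (ρ z - 1) * f z) (Ω \ K₂) := by
    refine continuousOn_cutoff_mul hK₁.isOpen_compl ((hρc.mono hsub₂).sub continuousOn_const)
      (hfc.mono fun z hz ↦ ⟨hz.1.1, by simpa using ⟨hz.2, hz.1.2⟩⟩) fun z hz hz1 ↦ ?_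
    have hz1 : z ∈ K₁ := by simpa using hz1
    have hone : 1 < 3 * infDist z K₂ / (infDist z K₁ + infDist z K₂) - 1 := by
      have := hpos₂ z hz.2
      rw [infDist_zero_of_mem hz1, zero_add, mul_div_cancel_right₀ _ this.ne']
      norm_num
    filter_upwards [ContinuousAt.eventually_lt continuousAt_const (hq z (hsub₂ hz)) hone] with w hw
    simp [hρ, min_eq_left hw.le]
  set F : ℂ → ℂ := fun z ↦ exp (ρ z * f z * (2 * π * I)) with hF
  have hF₂ : ∀ z, F z = exp ((ρ z - 1) * f z * (2 * π * I)) := fun z ↦ by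
    rw [hF, exp_eq_exp_iff_exists_int]
    exact ⟨f z, by ring⟩
  have hFc : ContinuousOn F (Ω \ {c}) := by
    intro z hz
    refine ContinuousAt.continuousWithinAt ?_
    by_cases hz1 : z ∈ K₁
    · have hz2 : z ∉ K₂ := fun h2 ↦ hz.2 (hK ⟨hz1, h2⟩)
      rw [funext hF₂]
      exact (hf₂.mul continuousOn_const).cexp.continuousAt ((hΩo.sdiff hK₂).mem_nhds ⟨hz.1, hz2⟩)
    · exact (hf₁.mul continuousOn_const).cexp.continuousAt ((hΩo.sdiff hK₁).mem_nhds ⟨hz.1, hz1⟩)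
  obtain ⟨n, g, hg, hFg⟩ := exists_zpow_mul_exp hΩo hΩ hc hFc fun z _ ↦ exp_ne_zero _
  refine ⟨n, fun z ↦ ρ z * f z * (2 * π * I) - g z,
    fun z ↦ (ρ z - 1) * f z * (2 * π * I) - g z,
    (hf₁.mul continuousOn_const).sub (hg.mono fun z hz ↦ ⟨hz.1, hsub₁ hz⟩),
    (hf₂.mul continuousOn_const).sub (hg.mono fun z hz ↦ ⟨hz.1, hsub₂ hz⟩),
    fun z hz ↦ ?_, fun z hz ↦ ?_, fun z ↦ by ring⟩
  · rw [Complex.exp_sub, div_eq_iff (exp_ne_zero _)]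
    exact hFg z ⟨hz.1, hsub₁ hz⟩
  · rw [Complex.exp_sub, div_eq_iff (exp_ne_zero _), ← hF₂]
    exact hFg z ⟨hz.1, hsub₂ hz⟩

lemma isPreconnected_ball_sdiff_singleton (c : ℂ) {r : ℝ} (hr : 0 < r) :
    IsPreconnected (ball c r \ {c}) := by
  have h : ball c r \ {c} = (fun ζ ↦ c + exp ζ) '' {ζ | ζ.re < Real.log r} := by
    ext z
    constructor
    · rintro ⟨hz, hzc⟩
      have h1 : z - c ≠ 0 := sub_ne_zero.mpr hzc
      refine ⟨log (z - c), ?_, by simp [exp_log h1]⟩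
      simpa [log_re] using Real.log_lt_log (norm_pos_iff.mpr h1)
        (by simpa [dist_eq_norm] using hz)
    · rintro ⟨ζ, hζ, rfl⟩
      refine ⟨?_, by simp [exp_ne_zero]⟩
      simp only [mem_ball, dist_eq_norm, add_sub_cancel_left, norm_exp]
      exact (Real.lt_log_iff_exp_lt hr).mp hζ
  rw [h]
  exact (convex_halfSpace_re_lt _).isPreconnected.image _ (by fun_prop)

/-- A plane domain stays connected after removing a point. -/
lemma isPreconnected_sdiff_singleton {Ω : Set ℂ} (hΩo : IsOpen Ω) (hΩ : IsPreconnected Ω) (c : ℂ) :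
    IsPreconnected (Ω \ {c}) := by
  classical
  by_cases hc : c ∈ Ω
  swap
  · rwa [sdiff_singleton_eq_self hc]
  obtain ⟨r, hr, hball⟩ := Metric.isOpen_iff.mp hΩo c hc
  refine isPreconnected_of_forall_constant fun f hf x hx y hy ↦ ?_
  have hf₀ : ContinuousOn f (ball c r \ {c}) := hf.mono (sdiff_subset_sdiff_left hball)
  have hw : c + (r / 2 : ℝ) ∈ ball c r \ {c} := by
    refine ⟨?_, by simpa using hr.ne'⟩
    simp only [mem_ball, dist_eq_norm, add_sub_cancel_left, norm_real, Real.norm_eq_abs]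
    rw [abs_of_pos] <;> linarith
  set b := f (c + (r / 2 : ℝ))
  have hf' : ContinuousOn (Function.update f c b) Ω := by
    intro z hz
    refine ContinuousAt.continuousWithinAt ?_
    by_cases hzc : z = c
    · subst hzc
      refine (continuousAt_const (y := b)).congr ?_
      filter_upwards [ball_mem_nhds z hr] with w hwr
      by_cases hwz : w = z
      · simp [hwz]
      · rw [Function.update_of_ne hwz]
        exact (isPreconnected_ball_sdiff_singleton z hr).constant hf₀ hw ⟨hwr, hwz⟩
    · refine (hf.continuousAt ((hΩo.sdiff isClosed_singleton).mem_nhds ⟨hz, hzc⟩)).congr ?_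
      filter_upwards [isOpen_ne.mem_nhds hzc] with w hw
      exact (Function.update_of_ne hw _ _).symm
  have := hΩ.constant hf' hx.1 hy.1
  rwa [Function.update_of_ne hx.2, Function.update_of_ne hy.2] at this

/-- A nonzero power of `z - c` has no logarithm around a compact set containing `c`. -/
lemma no_log_around_compact {Ω K : Set ℂ} (hΩo : IsOpen Ω) (hK : IsCompact K) (hKΩ : K ⊆ Ω)
    {c : ℂ} (hc : c ∈ K) {n : ℤ} {h : ℂ → ℂ} (hh : ContinuousOn h (Ω \ K))
    (he : ∀ z ∈ Ω \ K, exp (h z) = (z - c) ^ n) : n = 0 := by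
  classical
  obtain ⟨δ, hδ, hthick⟩ := hK.exists_cthickening_subset_open hΩo hKΩ
  have hfar : ∀ z, z ∉ Ω → δ < infDist z K := fun z hz ↦ by
    by_contra hle
    obtain ⟨y, hy, hzy⟩ := hK.exists_infDist_eq_dist ⟨c, hc⟩ z
    exact hz (hthick (mem_cthickening_of_dist_le z y δ K hy (hzy ▸ not_lt.mp hle)))
  set κ : ℂ → ℂ := fun z ↦ ((max 0 (min 1 (2 - 2 * infDist z K / δ)) : ℝ) : ℂ) with hκ
  have hκc : Continuous κ := by
    have := continuous_infDist_pt K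
    rw [hκ]; fun_prop
  have hκ1 : ∀ z, infDist z K < δ / 2 → κ z = 1 := by
    intro z hz
    have : 2 * infDist z K / δ ≤ 1 := by rw [div_le_one hδ]; linarith
    have h2 : min 1 (2 - 2 * infDist z K / δ) = 1 := min_eq_left (by linarith)
    simp [hκ, h2]
  have hκ0 : ∀ z, δ ≤ infDist z K → κ z = 0 := by
    intro z hz
    have : 2 ≤ 2 * infDist z K / δ := by rw [le_div_iff₀ hδ]; linarith
    have h2 : max 0 (min 1 (2 - 2 * infDist z K / δ)) = 0 :=
      max_eq_left ((min_le_right _ _).trans (by linarith))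
    simp [hκ, h2]
  have hκh : ContinuousOn (fun z ↦ κ z * h z) Kᶜ := by
    refine continuousOn_cutoff_mul hΩo hκc.continuousOn (hh.mono fun z hz ↦ ⟨hz.2, hz.1⟩)
      fun z _ hz ↦ ?_
    filter_upwards [(isOpen_lt continuous_const (continuous_infDist_pt K)).mem_nhds
      (hfar z hz)] with w hw
    exact hκ0 w hw.le
  have hne : ∀ z ∈ Kᶜ, z - c ≠ 0 := fun z hz h ↦ hz (sub_eq_zero.mp h ▸ hc)
  set G : ℂ → ℂ := fun z ↦ if z ∈ K then 1 else (z - c) ^ n * exp (-(κ z * h z)) with hG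
  have hGc : ContinuousOn G univ := by
    intro z _
    refine ContinuousAt.continuousWithinAt ?_
    by_cases hz : z ∈ K
    · refine (continuousAt_const (y := (1 : ℂ))).congr ?_
      have h1 : infDist z K < δ / 2 := by rw [infDist_zero_of_mem hz]; linarith
      filter_upwards [(isOpen_lt (continuous_infDist_pt K) continuous_const).mem_nhds h1,
        hΩo.mem_nhds (hKΩ hz)] with w hw hwΩ
      by_cases hwK : w ∈ K
      · simp [hG, hwK]
      · have := exp_ne_zero (h w)
        simp only [hG, hwK, if_false, hκ1 w hw, ← he w ⟨hwΩ, hwK⟩, one_mul, Complex.exp_neg]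
        field_simp
    · have h1 : ContinuousOn (fun z ↦ (z - c) ^ n * exp (-(κ z * h z))) Kᶜ :=
        ((continuousOn_id.sub continuousOn_const).zpow₀ _ fun z hz ↦ Or.inl (hne z hz)).mul
          hκh.neg.cexp
      refine (h1.continuousAt (hK.isClosed.isOpen_compl.mem_nhds hz)).congr ?_
      filter_upwards [hK.isClosed.isOpen_compl.mem_nhds hz] with w hw
      have hw : w ∉ K := hw
      simp [hG, hw]
  have hsc : IsSimplyConnected (univ : Set ℂ) :=
    haveI := (convex_univ (𝕜 := ℝ) (E := ℂ)).contractibleSpace univ_nonempty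
    SimplyConnectedSpace.ofContractible _
  obtain ⟨H, hH, hHe⟩ := exists_continuousOn_eqOn_exp_comp hsc isOpen_univ hGc (by
    rintro ⟨z, -, h⟩
    by_cases hz : z ∈ K
    · simp [hG, hz] at h
    · simp [hG, hz, exp_ne_zero, zpow_ne_zero, hne z hz] at h)
  obtain ⟨M, hM⟩ := hK.isBounded.subset_closedBall c
  have hM0 : 0 ≤ M := dist_nonneg.trans (hM hc)
  refine no_log_on_sphere (c := c) (r := M + δ) (by linarith) (hH.mono (subset_univ _)) ?_
  intro z hz
  have hd : δ ≤ infDist z K := by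
    refine (le_infDist ⟨c, hc⟩).mpr fun w hw ↦ ?_
    have h1 : dist w c ≤ M := hM hw
    have h2 : dist z c = M + δ := hz
    have h3 := dist_triangle z w c
    linarith
  have hzK : z ∉ K := fun h ↦ by rw [infDist_zero_of_mem h] at hd; linarith
  have : exp (H z) = G z := hHe (mem_univ z)
  simp [this, hG, hzK, hκ0 z hd]

/-- If neither of two closed sets meeting in one point separates `x` from `y`, and one of them is
a compact subset of the domain, then their union does not separate `x` from `y`. -/
lemma not_separated_union {Ω : Set ℂ} (hΩo : IsOpen Ω) (hΩ : IsSimplyConnected Ω) {c : ℂ}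
    {K₁ K₂ : Set ℂ} (hK₁ : IsClosed K₁) (hK₂ : IsCompact K₂) (hK₂Ω : K₂ ⊆ Ω) (hc₁ : c ∈ K₁)
    (hc₂ : c ∈ K₂) (hK : K₁ ∩ K₂ ⊆ {c}) {x y : ℂ} (hx : x ∈ Ω \ (K₁ ∪ K₂))
    (hy : y ∈ Ω \ (K₁ ∪ K₂)) (h₁ : ∀ f : ℂ → ℤ, ContinuousOn f (Ω \ K₁) → f x = f y)
    (h₂ : ∀ f : ℂ → ℤ, ContinuousOn f (Ω \ K₂) → f x = f y) (f : ℂ → ℤ)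
    (hf : ContinuousOn f (Ω \ (K₁ ∪ K₂))) : f x = f y := by
  obtain ⟨n, l₁, l₂, hl₁, hl₂, he₁, he₂, hl⟩ :=
    exists_log_sub_log hΩo hΩ (hK₂Ω hc₂) hK₁ hK₂.isClosed hc₁ hc₂ hK hf
  obtain rfl := no_log_around_compact hΩo hK₂ hK₂Ω hc₂ hl₂ he₂
  obtain ⟨k₁, hk₁, hk₁'⟩ := exists_int_of_exp_eq_one hl₁ (by simpa using he₁)
  obtain ⟨k₂, hk₂, hk₂'⟩ := exists_int_of_exp_eq_one hl₂ (by simpa using he₂)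
  have key : ∀ z ∈ Ω \ (K₁ ∪ K₂), f z = k₁ z - k₂ z := by
    rintro z ⟨hz, hz'⟩
    simp only [mem_union, not_or] at hz'
    have h := hl z
    rw [hk₁' z ⟨hz, hz'.1⟩, hk₂' z ⟨hz, hz'.2⟩, ← sub_mul] at h
    exact_mod_cast (mul_right_cancel₀ two_pi_I_ne_zero h).symm
  rw [key x hx, key y hy, h₁ k₁ hk₁, h₂ k₂ hk₂]

/-- A half-open Jordan arc in `Ω` starting on the boundary does not separate `Ω`. -/
lemma arc_not_separating {Ω : Set ℂ} (hΩo : IsOpen Ω) (hΩ : IsSimplyConnected Ω) {γ : ℝ → ℂ}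
    {s : ℝ} (hs : 0 ≤ s) (hγc : ContinuousOn γ (Icc 0 s)) (hγi : InjOn γ (Icc 0 s))
    (hγΩ : ∀ t ∈ Ioc (0 : ℝ) s, γ t ∈ Ω) {x y : ℂ} (hx : x ∈ Ω \ γ '' Icc 0 s)
    (hy : y ∈ Ω \ γ '' Icc 0 s) (f : ℂ → ℤ) (hf : ContinuousOn f (Ω \ γ '' Icc 0 s)) :
    f x = f y := by
  have hΩc : IsPreconnected Ω := hΩ.isPathConnected.isConnected.isPreconnected
  have hloc : ∀ t : Icc (0 : ℝ) s, ∃ O : Set (Icc (0 : ℝ) s), IsOpen O ∧ t ∈ O ∧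
      ∀ a b : Icc (0 : ℝ) s, Icc a b ⊆ O →
        ∀ f : ℂ → ℤ, ContinuousOn f (Ω \ γ '' Icc (a : ℝ) b) → f x = f y := by
    intro t
    have hxt : x ∈ Ω \ {γ t} := ⟨hx.1, fun h ↦ hx.2 (h ▸ mem_image_of_mem γ t.2)⟩
    have hyt : y ∈ Ω \ {γ t} := ⟨hy.1, fun h ↦ hy.2 (h ▸ mem_image_of_mem γ t.2)⟩
    have hpc : IsPathConnected (Ω \ {γ t}) :=
      ((hΩo.sdiff isClosed_singleton).isConnected_iff_isPathConnected).mp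
        ⟨⟨x, hxt⟩, isPreconnected_sdiff_singleton hΩo hΩc _⟩
    obtain ⟨p, hp⟩ := hpc.joinedIn x hxt y hyt
    have hcl : IsClosed (range p) := (isCompact_range p.continuous).isClosed
    have hγ' : Continuous fun u : Icc (0 : ℝ) s ↦ γ u :=
      continuousOn_iff_continuous_domRestrict.mp hγc
    refine ⟨(fun u : Icc (0 : ℝ) s ↦ γ u) ⁻¹' (range p)ᶜ, hcl.isOpen_compl.preimage hγ', ?_, ?_⟩
    · rintro ⟨u, hu⟩
      exact (hp u).2 hu
    · intro a b hab g hg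
      have hsub : range p ⊆ Ω \ γ '' Icc (a : ℝ) b := by
        rintro z ⟨u, rfl⟩
        refine ⟨(hp u).1, ?_⟩
        rintro ⟨v, hv, hvu⟩
        have hvs : v ∈ Icc 0 s := ⟨a.2.1.trans hv.1, hv.2.trans b.2.2⟩
        have hmem : (⟨v, hvs⟩ : Icc (0 : ℝ) s) ∈ Icc a b := ⟨hv.1, hv.2⟩
        exact hab hmem ⟨u, hvu.symm⟩
      exact (isPreconnected_range p.continuous).constant (hg.mono hsub) ⟨0, p.source⟩
        ⟨1, p.target⟩
  choose O hOo hOt hO using hloc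
  obtain ⟨t, ht0, htm, ⟨m, hm⟩, ht⟩ := exists_monotone_Icc_subset_open_cover_Icc hs hOo
    fun t _ ↦ mem_iUnion.mpr ⟨t, hOt t⟩
  have main : ∀ n, ∀ f : ℂ → ℤ, ContinuousOn f (Ω \ γ '' Icc 0 (t n : ℝ)) → f x = f y := by
    intro n
    induction n with
    | zero =>
      have h := hO (t 0) (t 0) (t 0) (by simpa using hOt (t 0))
      rwa [show Icc ((t 0 : ℝ)) (t 0) = Icc 0 (t 0 : ℝ) by rw [ht0]] at h
    | succ n ih =>
      obtain ⟨i, hi⟩ := ht n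
      have h2 := hO i _ _ hi
      have hle : (t n : ℝ) ≤ t (n + 1) := htm (Nat.le_succ n)
      rcases (t n).2.1.eq_or_lt with h0 | h0
      · rwa [← h0] at h2
      · have hU : γ '' Icc 0 (t (n + 1) : ℝ) =
            γ '' Icc 0 (t n : ℝ) ∪ γ '' Icc (t n : ℝ) (t (n + 1)) := by
          rw [← image_union, Icc_union_Icc_eq_Icc h0.le hle]
        have hss : ∀ n, Icc 0 (t n : ℝ) ⊆ Icc 0 s := fun n ↦ Icc_subset_Icc_right (t n).2.2
        have hss' : Icc (t n : ℝ) (t (n + 1)) ⊆ Icc 0 s := Icc_subset_Icc h0.le (t (n + 1)).2.2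
        rw [hU]
        have hxy : ∀ z, z ∈ Ω \ γ '' Icc 0 s →
            z ∈ Ω \ (γ '' Icc 0 (t n : ℝ) ∪ γ '' Icc (t n : ℝ) (t (n + 1))) := fun z hz ↦
          ⟨hz.1, fun h ↦ hz.2 (image_mono (hss (n + 1)) (hU ▸ h))⟩
        refine not_separated_union hΩo hΩ (c := γ (t n))
          (isCompact_Icc.image_of_continuousOn (hγc.mono (hss n))).isClosed
          (isCompact_Icc.image_of_continuousOn (hγc.mono hss')) ?_
          (mem_image_of_mem γ ⟨h0.le, le_rfl⟩) (mem_image_of_mem γ ⟨le_rfl, hle⟩) ?_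
          (hxy x hx) (hxy y hy) ih h2
        · rintro _ ⟨u, hu, rfl⟩
          exact hγΩ u ⟨h0.trans_le hu.1, (hss' hu).2⟩
        · rintro _ ⟨⟨u, hu, rfl⟩, v, hv, huv⟩
          obtain rfl := hγi (hss' hv) (hss n hu) huv
          rw [mem_singleton_iff, le_antisymm hu.2 hv.1]
  refine main m f ?_
  rwa [hm m le_rfl]

/-- If the integer-valued continuous functions on an open set `W` are all affine functions of a
nonconstant one, then `W` has exactly two components. -/
lemma exists_two_components_of_affine {X : Type*} [TopologicalSpace X] {W : Set X} (hW : IsOpen W)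
    {w : X → ℤ} (hw : ContinuousOn w W) {x y : X} (hx : x ∈ W) (hy : y ∈ W) (hxy : w x ≠ w y)
    (haff : ∀ f : X → ℤ, ContinuousOn f W → ∃ n d : ℤ, ∀ z ∈ W, f z = n * w z + d) :
    ∃ U V : Set X, IsOpen U ∧ IsOpen V ∧ IsConnected U ∧ IsConnected V ∧ Disjoint U V ∧
      U ∪ V = W := by
  classical
  set U := W ∩ w ⁻¹' {w x} with hU
  set V := W ∩ w ⁻¹' {w x}ᶜ with hV
  have hUo : IsOpen U := hw.isOpen_inter_preimage hW (isOpen_discrete _)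
  have hVo : IsOpen V := hw.isOpen_inter_preimage hW (isOpen_discrete _)
  have hdisj : Disjoint U V :=
    (disjoint_compl_right.preimage w).mono inter_subset_right inter_subset_right
  have hUV : U ∪ V = W := by rw [← inter_union_distrib_left, ← preimage_union]; simp
  have hpiece : ∀ P Q : Set X, IsOpen P → IsOpen Q → Disjoint P Q → P ∪ Q = W → ∀ f : X → ℤ,
      ContinuousOn f P → ContinuousOn (P.piecewise f 0) W := by
    intro P Q hP hQ hPQ hPQW f hf
    rw [← hPQW]
    refine ContinuousOn.union_of_isOpen ?_ ?_ hP hQ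
    · exact hf.congr (piecewise_eqOn _ _ _)
    · exact continuousOn_const.congr fun z hz ↦
        piecewise_eq_of_notMem _ _ _ (disjoint_right.mp hPQ hz)
  have hconn : ∀ P Q : Set X, IsOpen P → IsOpen Q → Disjoint P Q → P ∪ Q = W →
      (∀ z ∈ P, ∀ z' ∈ P, w z = w z') → IsPreconnected P := by
    intro P Q hP hQ hPQ hPQW hconst
    refine isPreconnected_of_forall_constant fun f hf z hz z' hz' ↦ ?_
    obtain ⟨n, d, h⟩ := haff _ (hpiece P Q hP hQ hPQ hPQW (fun z ↦ if f z then 1 else 0)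
      ((continuous_of_discreteTopology
        (f := fun b : Bool ↦ if b then (1 : ℤ) else 0)).comp_continuousOn hf))
    have hPW : P ⊆ W := hPQW ▸ subset_union_left
    have e := h z (hPW hz)
    rw [hconst z hz z' hz', ← h z' (hPW hz'), piecewise_eq_of_mem _ _ _ hz,
      piecewise_eq_of_mem _ _ _ hz'] at e
    cases h1 : f z <;> cases h2 : f z' <;> simp_all
  have hxU : x ∈ U := ⟨hx, rfl⟩
  have hyV : y ∈ V := ⟨hy, fun h ↦ hxy h.symm⟩
  refine ⟨U, V, hUo, hVo, ⟨⟨x, hxU⟩, hconn U V hUo hVo hdisj hUV ?_⟩, ⟨⟨y, hyV⟩,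
    hconn V U hVo hUo hdisj.symm (union_comm U V ▸ hUV) ?_⟩, hdisj, hUV⟩
  · rintro z ⟨-, hz⟩ z' ⟨-, hz'⟩
    exact hz.trans hz'.symm
  · obtain ⟨n, d, h⟩ := haff _ (hpiece U V hUo hVo hdisj hUV (fun _ ↦ 1) continuousOn_const)
    have h1 : 1 = n * w x + d := by rw [← h x hx, Set.piecewise, if_pos hxU]
    have h0 : ∀ z ∈ V, 0 = n * w z + d := fun z hz ↦ by
      rw [← h z hz.1, Set.piecewise, if_neg (disjoint_right.mp hdisj hz), Pi.zero_apply]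
    intro z hz z' hz'
    have hn : n ≠ 0 := by
      rintro rfl
      have := h0 y hyV
      simp only [zero_mul, zero_add] at h1 this
      omega
    refine mul_left_cancel₀ hn ?_
    linarith [h0 z hz, h0 z' hz']

/-- If `p` can be joined to the complement of the simply connected domain `Ω` off `U ⊆ Ω`, then
`z - p` has a continuous logarithm on `U`. -/
lemma exists_log_of_joinedIn {Ω U : Set ℂ} (hΩo : IsOpen Ω) (hΩ : IsSimplyConnected Ω)
    (hU : U ⊆ Ω) {p q : ℂ} (h : JoinedIn Uᶜ p q) (hq : q ∉ Ω) :
    ∃ L : ℂ → ℂ, ContinuousOn L U ∧ ∀ z ∈ U, exp (L z) = z - p := by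
  obtain ⟨f, hf, hf'⟩ := exists_exp_of_joinedIn h
  obtain ⟨g, hg, hg'⟩ := Complex.exists_continuousOn_eqOn_exp_comp hΩ hΩo (g := fun z ↦ z - q)
    (by fun_prop) (by rintro ⟨z, hz, hzq⟩; exact hq (sub_eq_zero.mp hzq ▸ hz))
  refine ⟨fun z ↦ g z + f z, (hg.mono hU).add hf, fun z hz ↦ ?_⟩
  rw [exp_add, hf' z hz, ← show exp (g z) = z - q from hg' (hU hz)]

/-- Two points of an arc are joined within it. -/
lemma joinedIn_image_Icc {γ : ℝ → ℂ} {a b : ℝ} (hγ : ContinuousOn γ (Icc a b)) {S : Set ℂ}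
    (hS : γ '' Icc a b ⊆ S) {s t : ℝ} (hs : s ∈ Icc a b) (ht : t ∈ Icc a b) :
    JoinedIn S (γ s) (γ t) :=
  ((((convex_Icc a b).isPathConnected ⟨s, hs⟩).image' hγ).joinedIn _ (mem_image_of_mem γ hs) _
    (mem_image_of_mem γ ht)).mono hS

/-- A logarithm of an integral power of `z - c` off a nonseparating set is, up to an additive
constant, a multiple of a logarithm of `z - c`. -/
lemma exists_log_eq_mul_log_add {S : Set ℂ}
    (hS : ∀ f : ℂ → ℤ, ContinuousOn f S → ∀ x ∈ S, ∀ y ∈ S, f x = f y) {c : ℂ} {n : ℤ} {h L : ℂ → ℂ}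
    (hh : ContinuousOn h S) (hL : ContinuousOn L S) (he : ∀ z ∈ S, exp (h z) = (z - c) ^ n)
    (hLe : ∀ z ∈ S, exp (L z) = z - c) :
    ∃ d : ℤ, ∀ z ∈ S, h z = n * L z + d * (2 * π * I) := by
  obtain ⟨k, hk, hk'⟩ := exists_int_of_exp_eq_one (h := fun z ↦ h z - n * L z) (S := S)
    (hh.sub (continuousOn_const.mul hL)) fun z hz ↦ by
      have : z - c ≠ 0 := hLe z hz ▸ exp_ne_zero _
      rw [exp_sub, he z hz, exp_int_mul, hLe z hz, div_self (zpow_ne_zero _ this)]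
  rcases S.eq_empty_or_nonempty with rfl | ⟨x, hx⟩
  · exact ⟨0, by simp⟩
  · refine ⟨k x, fun z hz ↦ ?_⟩
    rw [hS k hk x hx z hz, ← hk' z hz]; ring

/-- Logarithms of `z - c` defined off two closed sets `K₁`, `K₂` meeting at `c` do not differ by a
constant. -/
lemma not_log_sub_log_const {Ω : Set ℂ} (hΩo : IsOpen Ω) {c : ℂ}
    (hc : c ∈ Ω) {K₁ K₂ : Set ℂ} (hK₁ : IsClosed K₁) (hK₂ : IsClosed K₂)
    (hK : K₁ ∩ K₂ ⊆ {c}) {L₁ L₂ : ℂ → ℂ} (hL₁ : ContinuousOn L₁ (Ω \ K₁))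
    (hL₂ : ContinuousOn L₂ (Ω \ K₂)) (he₁ : ∀ z ∈ Ω \ K₁, exp (L₁ z) = z - c)
    (he₂ : ∀ z ∈ Ω \ K₂, exp (L₂ z) = z - c) (k : ℤ) :
    ¬ ∀ z ∈ Ω \ (K₁ ∪ K₂), L₁ z - L₂ z = k * (2 * π * I) := by
  classical
  intro hk
  obtain ⟨r, hr, hrΩ⟩ := Metric.nhds_basis_closedBall.mem_iff.mp (hΩo.mem_nhds hc)
  set L : ℂ → ℂ := (Ω \ K₁).piecewise L₁ (fun z ↦ L₂ z + k * (2 * π * I)) with hL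
  have hU : EqOn L L₁ (Ω \ K₁) := piecewise_eqOn _ _ _
  have hV : EqOn L (fun z ↦ L₂ z + k * (2 * π * I)) (Ω \ K₂) := by
    intro z hz
    by_cases h : z ∈ K₁
    · exact piecewise_eq_of_notMem _ _ _ fun h' ↦ h'.2 h
    · rw [hU ⟨hz.1, h⟩]
      have := hk z ⟨hz.1, by simp [h, hz.2]⟩
      show L₁ z = L₂ z + k * (2 * π * I)
      rw [← this]; ring
  have hcont : ContinuousOn L ((Ω \ K₁) ∪ (Ω \ K₂)) :=
    (hL₁.congr hU).union_of_isOpen ((hL₂.add continuousOn_const).congr hV) (hΩo.sdiff hK₁)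
      (hΩo.sdiff hK₂)
  have hsub : sphere c r ⊆ (Ω \ K₁) ∪ (Ω \ K₂) := by
    intro z hz
    have hzΩ := hrΩ (sphere_subset_closedBall hz)
    by_contra hcon
    simp only [mem_union, Set.mem_sdiff, hzΩ, true_and, not_or, not_not] at hcon
    have : z = c := hK hcon
    rw [this, mem_sphere, dist_self] at hz
    exact hr.ne hz
  have := no_log_on_sphere (n := 1) hr (hcont.mono hsub) fun z hz ↦ by
    rw [zpow_one]
    rcases hsub hz with h | h
    · rw [hU h, he₁ z h]
    · rw [hV h]
      show exp (L₂ z + k * (2 * π * I)) = z - c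
      rw [exp_add, he₂ z h, exp_int_mul_two_pi_mul_I, mul_one]
  exact one_ne_zero this

/-- A crosscut separates a simply connected domain into exactly two components. -/
lemma crosscut_two_components {Ω : Set ℂ} (hΩo : IsOpen Ω) (hΩ : IsSimplyConnected Ω)
    {γ : ℝ → ℂ} (hγc : ContinuousOn γ (Icc 0 1)) (hγi : InjOn γ (Icc 0 1))
    (hγΩ : ∀ t ∈ Ioo (0 : ℝ) 1, γ t ∈ Ω) (hγ0 : γ 0 ∉ Ω) (hγ1 : γ 1 ∉ Ω) :
    ∃ U V : Set ℂ, IsOpen U ∧ IsOpen V ∧ IsConnected U ∧ IsConnected V ∧ Disjoint U V ∧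
      U ∪ V = Ω \ γ '' Icc 0 1 := by
  have hsub₁ : Icc (0 : ℝ) (1 / 2) ⊆ Icc 0 1 := Icc_subset_Icc_right (by norm_num)
  have hsub₂ : Icc (1 / 2 : ℝ) 1 ⊆ Icc 0 1 := Icc_subset_Icc_left (by norm_num)
  set K₁ := γ '' Icc 0 (1 / 2) with hK₁
  set K₂ := γ '' Icc (1 / 2) 1 with hK₂
  set c := γ (1 / 2) with hc
  have hcΩ : c ∈ Ω := hγΩ _ (by norm_num)
  have hc₁ : c ∈ K₁ := mem_image_of_mem γ (by norm_num)
  have hc₂ : c ∈ K₂ := mem_image_of_mem γ (by norm_num)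
  have hcl₁ : IsClosed K₁ := (isCompact_Icc.image_of_continuousOn (hγc.mono hsub₁)).isClosed
  have hcl₂ : IsClosed K₂ := (isCompact_Icc.image_of_continuousOn (hγc.mono hsub₂)).isClosed
  have hA : γ '' Icc 0 1 = K₁ ∪ K₂ := by
    rw [hK₁, hK₂, ← image_union, Icc_union_Icc_eq_Icc (by norm_num) (by norm_num)]
  have hK : K₁ ∩ K₂ ⊆ {c} := by
    rintro _ ⟨⟨u, hu, rfl⟩, v, hv, huv⟩
    obtain rfl := hγi (hsub₂ hv) (hsub₁ hu) huv
    rw [mem_singleton_iff, le_antisymm hu.2 hv.1]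
  have hns₁ : ∀ f : ℂ → ℤ, ContinuousOn f (Ω \ K₁) → ∀ x ∈ Ω \ K₁, ∀ y ∈ Ω \ K₁, f x = f y :=
    fun f hf x hx y hy ↦ arc_not_separating hΩo hΩ (by norm_num) (hγc.mono hsub₁)
      (hγi.mono hsub₁) (fun t ht ↦ hγΩ t ⟨ht.1, ht.2.trans_lt (by norm_num)⟩) hx hy f hf
  have hrev : MapsTo (fun t : ℝ ↦ 1 - t) (Icc 0 (1 / 2)) (Icc 0 1) := fun t ht ↦
    ⟨by linarith [ht.2], by linarith [ht.1]⟩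
  have hrevK : (fun t : ℝ ↦ γ (1 - t)) '' Icc 0 (1 / 2) = K₂ := by
    rw [hK₂, ← image_image γ (fun t : ℝ ↦ 1 - t), image_const_sub_Icc]
    norm_num
  have hns₂ : ∀ f : ℂ → ℤ, ContinuousOn f (Ω \ K₂) → ∀ x ∈ Ω \ K₂, ∀ y ∈ Ω \ K₂, f x = f y := by
    rw [← hrevK]
    exact fun f hf x hx y hy ↦ arc_not_separating hΩo hΩ (by norm_num)
      (hγc.comp (by fun_prop) hrev)
      (hγi.comp (fun a _ b _ h ↦ by simpa using h) hrev)
      (fun t ht ↦ hγΩ _ ⟨by linarith [ht.2], by linarith [ht.1]⟩) hx hy f hf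
  obtain ⟨L₁, hL₁, he₁⟩ := exists_log_of_joinedIn hΩo hΩ (U := Ω \ K₁) sdiff_subset
    (joinedIn_image_Icc (hγc.mono hsub₁) (S := (Ω \ K₁)ᶜ) (fun z hz h ↦ h.2 hz) (s := 1 / 2)
      (t := 0) (by norm_num) (by norm_num)) hγ0
  obtain ⟨L₂, hL₂, he₂⟩ := exists_log_of_joinedIn hΩo hΩ (U := Ω \ K₂) sdiff_subset
    (joinedIn_image_Icc (hγc.mono hsub₂) (S := (Ω \ K₂)ᶜ) (fun z hz h ↦ h.2 hz) (s := 1 / 2)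
      (t := 1) (by norm_num) (by norm_num)) hγ1
  rw [hA]
  have hs₁ : Ω \ (K₁ ∪ K₂) ⊆ Ω \ K₁ := sdiff_subset_sdiff_right subset_union_left
  have hs₂ : Ω \ (K₁ ∪ K₂) ⊆ Ω \ K₂ := sdiff_subset_sdiff_right subset_union_right
  obtain ⟨w, hw, hw'⟩ := exists_int_of_exp_eq_one (h := fun z ↦ L₁ z - L₂ z)
    ((hL₁.mono hs₁).sub (hL₂.mono hs₂)) fun z hz ↦ by
      rw [exp_sub, he₁ z (hs₁ hz), he₂ z (hs₂ hz), div_self]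
      exact he₁ z (hs₁ hz) ▸ exp_ne_zero _
  have hnc := not_log_sub_log_const hΩo hcΩ hcl₁ hcl₂ hK hL₁ hL₂ he₁ he₂
  obtain ⟨x, hx, -⟩ : ∃ x ∈ Ω \ (K₁ ∪ K₂), ¬ L₁ x - L₂ x = (0 : ℤ) * (2 * π * I) := by
    simpa only [not_forall, exists_prop] using hnc 0
  obtain ⟨y, hy, hxy⟩ : ∃ y ∈ Ω \ (K₁ ∪ K₂), ¬ L₁ y - L₂ y = (w x) * (2 * π * I) := by
    simpa only [not_forall, exists_prop] using hnc (w x)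
  refine exists_two_components_of_affine (hΩo.sdiff (hcl₁.union hcl₂)) hw hx hy ?_ ?_
  · intro h
    exact hxy (h ▸ hw' y hy)
  · intro f hf
    obtain ⟨n, h₁, h₂, hh₁, hh₂, hhe₁, hhe₂, hh⟩ :=
      exists_log_sub_log hΩo hΩ hcΩ hcl₁ hcl₂ hc₁ hc₂ hK hf
    obtain ⟨d₁, hd₁⟩ := exists_log_eq_mul_log_add hns₁ hh₁ hL₁ hhe₁ he₁
    obtain ⟨d₂, hd₂⟩ := exists_log_eq_mul_log_add hns₂ hh₂ hL₂ hhe₂ he₂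
    refine ⟨n, d₁ - d₂, fun z hz ↦ ?_⟩
    have e1 := hh z
    have e2 := hw' z hz
    rw [hd₁ z (hs₁ hz), hd₂ z (hs₂ hz)] at e1
    have e3 : (f z : ℂ) * (2 * π * I) = (n * w z + (d₁ - d₂)) * (2 * π * I) := by
      linear_combination (n : ℂ) * e2 - e1
    exact_mod_cast mul_right_cancel₀ two_pi_I_ne_zero e3

/-- A point off one side `U` of a crosscut can be joined to the complement of the domain off
`U`. -/
lemma exists_joinedIn_compl_of_crosscut {Ω : Set ℂ} (hΩ : IsPathConnected Ω) {γ : ℝ → ℂ}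
    (hγc : ContinuousOn γ (Icc 0 1)) (hγΩ : ∀ t ∈ Ioo (0 : ℝ) 1, γ t ∈ Ω) (hγ1 : γ 1 ∉ Ω)
    {U V : Set ℂ} (hU : IsOpen U) (hV : IsOpen V) (hUV : Disjoint U V)
    (hW : U ∪ V = Ω \ γ '' Icc 0 1) {p : ℂ} (hp : p ∉ U) : ∃ q, q ∉ Ω ∧ JoinedIn Uᶜ p q := by
  have hAU : γ '' Icc 0 1 ⊆ Uᶜ := fun z hz hzU ↦
    (hW ▸ subset_union_left (t := V) hzU : z ∈ Ω \ γ '' Icc 0 1).2 hz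
  have hA : ∀ z ∈ γ '' Icc 0 1, JoinedIn Uᶜ z (γ 1) := by
    rintro _ ⟨t, ht, rfl⟩
    exact joinedIn_image_Icc hγc hAU ht (by norm_num)
  by_cases hpΩ : p ∉ Ω
  · exact ⟨p, hpΩ, JoinedIn.refl hp⟩
  refine ⟨γ 1, hγ1, ?_⟩
  by_cases hpA : p ∈ γ '' Icc 0 1
  · exact hA p hpA
  push Not at hpΩ
  have hpV : p ∈ V := ((hW ▸ ⟨hpΩ, hpA⟩ : p ∈ U ∪ V)).resolve_left hp
  obtain ⟨σ, hσ⟩ := hΩ.joinedIn p hpΩ (γ (1 / 2)) (hγΩ _ (by norm_num))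
  have hAcl : IsClosed (γ '' Icc 0 1) := (isCompact_Icc.image_of_continuousOn hγc).isClosed
  obtain ⟨t, ht, hmin⟩ := (hAcl.preimage σ.continuous).isCompact.exists_isLeast
    ⟨1, by simpa using ⟨(2 : ℝ)⁻¹, by norm_num, rfl⟩⟩
  have hlt : ∀ s < t, σ s ∈ Ω \ γ '' Icc 0 1 := fun s hs ↦
    ⟨hσ s, fun h ↦ absurd (hmin h) (not_le.mpr hs)⟩
  have ht0 : 0 < t := by
    refine lt_of_le_of_ne unitInterval.nonneg' fun h ↦ hpA ?_
    have : σ t ∈ γ '' Icc 0 1 := ht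
    rwa [← h, σ.source] at this
  have hVs : σ '' Iio t ⊆ V := by
    refine IsPreconnected.subset_left_of_subset_union hV hU hUV.symm ?_
      ⟨p, ⟨0, ht0, σ.source⟩, hpV⟩ (isPreconnected_Iio.image σ σ.continuous.continuousOn)
    rintro _ ⟨s, hs, rfl⟩
    rw [union_comm, hW]
    exact hlt s hs
  have hσU : σ '' Iic t ⊆ Uᶜ := by
    rintro _ ⟨s, hs, rfl⟩
    rcases (mem_Iic.mp hs).lt_or_eq with h | rfl
    · exact disjoint_right.mp hUV (hVs ⟨s, h, rfl⟩)
    · exact hAU ht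
  have hpt : JoinedIn Uᶜ p (σ t) := by
    have hc : IsPathConnected ((fun s : ℝ ↦ σ (projIcc 0 1 zero_le_one s)) '' Icc 0 t) :=
      ((convex_Icc 0 (t : ℝ)).isPathConnected ⟨0, le_rfl, t.2.1⟩).image
        (σ.continuous.comp continuous_projIcc)
    have := hc.joinedIn p ⟨0, ⟨le_rfl, t.2.1⟩, by simp⟩ (σ t) ⟨t, ⟨t.2.1, le_rfl⟩, by simp⟩
    refine this.mono ?_
    rintro _ ⟨s, hs, rfl⟩
    refine hσU ⟨_, ?_, rfl⟩
    rw [mem_Iic, ← Subtype.coe_le_coe, projIcc_of_mem _ ⟨hs.1, hs.2.trans t.2.2⟩]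
    exact hs.2
  exact hpt.trans (hA _ ht)

/-- `Walk E g u v n h` says that there is a walk of length `n` from `u` to `v` along the relation
`E`, such that the product of the labels `g` of its steps is `h`. -/
inductive Walk {V G : Type*} [Group G] (E : V → V → Prop) (g : V → V → G) : V → V → ℕ → G → Prop
  | nil (u : V) : Walk E g u u 0 1
  | cons {u v w : V} {n : ℕ} {h : G} (huv : E u v) (hw : Walk E g v w n h) :
      Walk E g u w (n + 1) (g u v * h)

namespace Walk

variable {V G : Type*} [Group G] {E E' : V → V → Prop} {g : V → V → G}

lemma single {u v : V} (h : E u v) : Walk E g u v 1 (g u v) := by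
  simpa using cons (g := g) h (nil v)

lemma append {u v w : V} {n n' : ℕ} {h h' : G} (W : Walk E g u v n h) (W' : Walk E g v w n' h') :
    Walk E g u w (n + n') (h * h') := by
  induction W with
  | nil => simpa using W'
  | cons huv _ ih =>
    rw [mul_assoc, Nat.add_right_comm]
    exact cons huv (ih W')

/-- A walk whose endpoints are separated by `D` crosses an edge whose endpoints are separated
by `D`. -/
lemma exists_crossing {α : Type*} {D : V → α} {u w : V} {n : ℕ} {h : G} (W : Walk E g u w n h)
    (huw : D u ≠ D w) : ∃ x y n₁ n₂ h₁ h₂, E x y ∧ D x = D u ∧ D x ≠ D y ∧ Walk E g u x n₁ h₁ ∧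
      Walk E g y w n₂ h₂ ∧ n = n₁ + 1 + n₂ ∧ h = h₁ * (g x y * h₂) := by
  induction W with
  | nil => exact absurd rfl huw
  | @cons u v w n h huv W ih =>
    by_cases hD : D u = D v
    · obtain ⟨x, y, n₁, n₂, h₁, h₂, hxy, hx, hne, W₁, W₂, rfl, rfl⟩ := ih (hD ▸ huw)
      exact ⟨x, y, n₁ + 1, n₂, g u v * h₁, h₂, hxy, hx.trans hD.symm, hne, cons huv W₁, W₂,
        by omega, by group⟩
    · exact ⟨u, v, 0, n, 1, h, huv, rfl, hD, nil u, W, by omega, by group⟩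

/-- A closed walk through the only edge separated by `D` is trivial if shorter ones are. -/
lemma eq_one_of_crossing {α : Type*} {D : V → α} {x y u : V} {n₁ n₂ : ℕ} {h₁ h₂ : G}
    (hD : ∀ u v, E u v → D u = D v ∨ (u = x ∧ v = y) ∨ (u = y ∧ v = x)) (hxy : D x ≠ D y)
    (hg : g y x * g x y = 1)
    (ih : ∀ k < n₁ + 1 + n₂, ∀ u h, Walk E g u u k h → h = 1)
    (W₁ : Walk E g u x n₁ h₁) (W₂ : Walk E g y u n₂ h₂) : h₁ * (g x y * h₂) = 1 := by
  obtain ⟨x', y', m₁, m₂, k₁, k₂, hE, hDx, hne, W₃, W₄, hn, hh⟩ :=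
    (W₂.append W₁).exists_crossing hxy.symm
  rcases hD _ _ hE with h | ⟨rfl, rfl⟩ | ⟨rfl, rfl⟩
  · exact absurd h hne
  · exact absurd hDx hxy
  · rw [ih m₁ (by omega) _ _ W₃, ih m₂ (by omega) _ _ W₄, one_mul, mul_one] at hh
    have : h₂ * h₁ * g y' x' = 1 := by rw [hh, hg]
    have h3 : g y' x' = h₁⁻¹ * h₂⁻¹ := by
      rw [← mul_inv_rev]; exact eq_inv_of_mul_eq_one_right this
    rw [h3]; group

/-- Push a walk along `f`, unless it runs through a bad edge. -/
lemma push {B : V → V → Prop} {f : V → V} {k : V → G}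
    (hk : ∀ u v, E u v → ¬ B u v → ∃ n, Walk E' g (f u) (f v) n ((k u)⁻¹ * g u v * k v))
    {u w : V} {n : ℕ} {h : G} (W : Walk E g u w n h) :
    (∃ x y n₁ n₂ h₁ h₂, E x y ∧ B x y ∧ Walk E g u x n₁ h₁ ∧ Walk E g y w n₂ h₂ ∧
      n = n₁ + 1 + n₂ ∧ h = h₁ * (g x y * h₂)) ∨
    ∃ n', Walk E' g (f u) (f w) n' ((k u)⁻¹ * h * k w) := by
  induction W with
  | nil u => exact .inr ⟨0, by simpa using nil (E := E') (g := g) (f u)⟩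
  | @cons u v w n h huv W ih =>
    by_cases hB : B u v
    · exact .inl ⟨u, v, 0, n, 1, h, huv, hB, nil u, W, by omega, by group⟩
    rcases ih with ⟨x, y, n₁, n₂, h₁, h₂, hxy, hBxy, W₁, W₂, rfl, rfl⟩ | ⟨n', W'⟩
    · exact .inl ⟨x, y, n₁ + 1, n₂, g u v * h₁, h₂, hxy, hBxy, cons huv W₁, W₂, by omega,
        by group⟩
    · obtain ⟨n'', W''⟩ := hk u v huv hB
      refine .inr ⟨n'' + n', ?_⟩
      convert! W''.append W' using 1
      group

end Walk

/-- The point of the plane with the given integral coordinates. -/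
def gridPt (v : ℤ × ℤ) : ℂ := ⟨v.1, v.2⟩

@[simp] lemma gridPt_re (v : ℤ × ℤ) : (gridPt v).re = v.1 := rfl
@[simp] lemma gridPt_im (v : ℤ × ℤ) : (gridPt v).im = v.2 := rfl

/-- Edges of the unit grid, contained in `U` and in the rows up to `m`. -/
structure GridEdge (U : Set ℂ) (m : ℤ) (u v : ℤ × ℤ) : Prop where
  adj : (u.2 = v.2 ∧ (v.1 = u.1 + 1 ∨ u.1 = v.1 + 1)) ∨
    (u.1 = v.1 ∧ (v.2 = u.2 + 1 ∨ u.2 = v.2 + 1))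
  left_le : u.2 ≤ m
  right_le : v.2 ≤ m
  subset : segment ℝ (gridPt u) (gridPt v) ⊆ U

lemma convex_reProdIm {s t : Set ℝ} (hs : Convex ℝ s) (ht : Convex ℝ t) :
    Convex ℝ (s ×ℂ t) :=
  (hs.linear_preimage reLm).inter (ht.linear_preimage imLm)

lemma segment_gridPt_subset (u v : ℤ × ℤ) :
    segment ℝ (gridPt u) (gridPt v) ⊆ uIcc (u.1 : ℝ) v.1 ×ℂ uIcc (u.2 : ℝ) v.2 :=
  (convex_reProdIm (convex_uIcc _ _) (convex_uIcc _ _)).segment_subset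
    ⟨left_mem_uIcc, left_mem_uIcc⟩ ⟨right_mem_uIcc, right_mem_uIcc⟩

lemma neg_div_mem_slitPlane {z a : ℂ} (ha : a ≠ 0) (h : ∀ t : ℝ, 0 ≤ t → z ≠ t * a) :
    -(z / a) ∈ slitPlane := by
  by_contra hcon
  rw [mem_slitPlane_iff, not_or, not_lt, not_not] at hcon
  simp only [neg_re, neg_im, neg_eq_zero, Left.neg_nonpos_iff] at hcon
  refine h _ hcon.1 ?_
  have : ((z / a).re : ℂ) = z / a := Complex.ext rfl (by simp [hcon.2])
  rw [this, div_mul_cancel₀ _ ha]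

lemma log_neg_sub_log_of_im_pos {ζ : ℂ} (h : 0 < ζ.im) : log (-ζ) - log ζ = -(π * I) := by
  rw [log, log, norm_neg, arg_neg_eq_arg_sub_pi_of_im_pos h]
  push_cast; ring

lemma log_neg_sub_log_of_im_neg {ζ : ℂ} (h : ζ.im < 0) : log (-ζ) - log ζ = π * I := by
  rw [log, log, norm_neg, arg_neg_eq_arg_add_pi_of_im_neg h]
  push_cast; ring

/-- Two branches of `log (z - p)` on a preconnected set differ by a constant. -/
lemma log_sub_log_const {S : Set ℂ} (hS : IsPreconnected S) {p a : ℂ} (ha : a ≠ 0) {L : ℂ → ℂ}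
    (hL : ContinuousOn L S) (hLe : ∀ z ∈ S, exp (L z) = z - p)
    (hslit : ∀ z ∈ S, (z - p) / a ∈ slitPlane) {x y : ℂ} (hx : x ∈ S) (hy : y ∈ S) :
    log ((x - p) / a) - L x = log ((y - p) / a) - L y := by
  have h := sub_eq_sub_of_exp_eq (f := fun z ↦ log ((z - p) / a)) (g := fun z ↦ L z - log a) hS
    (ContinuousOn.clog (by fun_prop) hslit)
    (hL.sub continuousOn_const) (fun z hz ↦ ?_) hx hy
  · linear_combination h
  · rw [exp_log (slitPlane_ne_zero (hslit z hz)), exp_sub, hLe z hz, exp_log ha]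

/-- A ray from a point below a top edge through the midpoint of this edge meets no other edge. -/
lemma GridEdge.ray_avoids {U : Set ℂ} {i m : ℤ} {p : ℂ} (hpU : p ∉ U)
    (hpre : p.re ∈ Icc (i : ℝ) (i + 1)) (hpim : p.im ∈ Ico (m : ℝ) (m + 1)) {u v : ℤ × ℤ}
    (he : GridEdge U (m + 1) u v)
    (hne : ¬ ((u = (i, m + 1) ∧ v = (i + 1, m + 1)) ∨ (u = (i + 1, m + 1) ∧ v = (i, m + 1))))
    {z : ℂ} (hz : z ∈ segment ℝ (gridPt u) (gridPt v)) {t : ℝ} (ht : 0 ≤ t) :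
    z - p ≠ t * ((⟨i + 1 / 2, m + 1⟩ : ℂ) - p) := by
  intro hzt
  obtain ⟨hzre, hzim⟩ := segment_gridPt_subset u v hz
  have hre : z.re = p.re + t * (i + 1 / 2 - p.re) := by
    have := congrArg re hzt
    simp at this
    linarith
  have him : z.im = p.im + t * (m + 1 - p.im) := by
    have := congrArg im hzt
    simp at this
    linarith
  have ht0 : 0 < t := by
    refine lt_of_le_of_ne ht fun h ↦ hpU ?_
    rw [← h] at hzt
    have : z = p := by simpa [sub_eq_zero] using hzt
    exact this ▸ he.subset hz
  have hul : (u.2 : ℝ) ≤ m + 1 := by exact_mod_cast he.left_le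
  have hvl : (v.2 : ℝ) ≤ m + 1 := by exact_mod_cast he.right_le
  have hzle : z.im ≤ m + 1 := hzim.2.trans (max_le hul hvl)
  have hzgt : (m : ℝ) < z.im := by nlinarith [hpim.1, hpim.2]
  have ht1 : t ≤ 1 := by
    by_contra h
    nlinarith [hpim.2]
  have hz1 : (i : ℝ) < z.re := by nlinarith [hpre.1, hpre.2]
  have hz2 : z.re < i + 1 := by nlinarith [hpre.1, hpre.2]
  rcases he.adj with ⟨h2, h1⟩ | ⟨h1, -⟩
  · rw [h2, uIcc_self] at hzim
    have hzv : z.im = v.2 := hzim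
    rw [hzv] at hzle hzgt
    have hvm : v.2 = m + 1 := le_antisymm (by exact_mod_cast hzle)
      (Int.add_one_le_iff.mpr (by exact_mod_cast hzgt))
    rcases h1 with h1 | h1
    · have hcast : (v.1 : ℝ) = u.1 + 1 := by exact_mod_cast h1
      rw [hcast, uIcc_of_le (by linarith)] at hzre
      have a1 : (i : ℝ) < (u.1 + 1 : ℤ) := by push_cast; exact hz1.trans_le hzre.2
      have a2 : (u.1 : ℝ) < (i + 1 : ℤ) := by push_cast; exact hzre.1.trans_lt hz2
      have a1 := Int.cast_lt.mp a1
      have a2 := Int.cast_lt.mp a2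
      exact hne (.inl ⟨Prod.ext (show u.1 = i by omega) (show u.2 = m + 1 by omega),
        Prod.ext (show v.1 = i + 1 by omega) hvm⟩)
    · have hcast : (u.1 : ℝ) = v.1 + 1 := by exact_mod_cast h1
      rw [hcast, uIcc_of_ge (by linarith)] at hzre
      have a1 : (i : ℝ) < (v.1 + 1 : ℤ) := by push_cast; exact hz1.trans_le hzre.2
      have a2 : (v.1 : ℝ) < (i + 1 : ℤ) := by push_cast; exact hzre.1.trans_lt hz2
      have a1 := Int.cast_lt.mp a1
      have a2 := Int.cast_lt.mp a2
      exact hne (.inr ⟨Prod.ext (show u.1 = i + 1 by omega) (show u.2 = m + 1 by omega),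
        Prod.ext (show v.1 = i by omega) hvm⟩)
  · rw [h1, uIcc_self] at hzre
    have hzv : z.re = v.1 := hzre
    rw [hzv] at hz1 hz2
    have a1 := Int.cast_lt.mp hz1
    have a2 : v.1 < i + 1 := by exact_mod_cast hz2
    omega

/-- If the square below a top edge contains a point outside `U`, there is a function which is
constant along every edge other than this top edge. -/
lemma exists_separating_function {U : Set ℂ} {i m : ℤ} {p : ℂ} {L : ℂ → ℂ}
    (hL : ContinuousOn L U) (hLe : ∀ z ∈ U, exp (L z) = z - p)
    (hpre : p.re ∈ Icc (i : ℝ) (i + 1)) (hpim : p.im ∈ Ico (m : ℝ) (m + 1))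
    (hseg : segment ℝ (gridPt (i, m + 1)) (gridPt (i + 1, m + 1)) ⊆ U) :
    ∃ D : ℤ × ℤ → ℂ, D (i, m + 1) ≠ D (i + 1, m + 1) ∧ ∀ u v, GridEdge U (m + 1) u v →
      D u = D v ∨ (u = (i, m + 1) ∧ v = (i + 1, m + 1)) ∨
        (u = (i + 1, m + 1) ∧ v = (i, m + 1)) := by
  have hpU : p ∉ U := fun h ↦ exp_ne_zero _ ((hLe p h).trans (sub_self p))
  set a : ℂ := (⟨i + 1 / 2, m + 1⟩ : ℂ) - p with ha_def
  have haim : 0 < a.im := by simpa [ha_def] using hpim.2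
  have ha : a ≠ 0 := fun h ↦ by simp [h] at haim
  refine ⟨fun v ↦ log ((gridPt v - p) / -a) - L (gridPt v), ?_, ?_⟩
  · have hslit : ∀ z ∈ segment ℝ (gridPt (i, m + 1)) (gridPt (i + 1, m + 1)),
        (z - p) / a ∈ slitPlane := by
      intro z hz
      have hzim : z.im = m + 1 := by
        have := (segment_gridPt_subset _ _ hz).2
        simpa using this
      have := neg_div_mem_slitPlane (z := -(z - p)) ha fun t ht h ↦ by
        have := congrArg im h
        simp [hzim] at this
        nlinarith [hpim.2]
      rwa [neg_div, neg_neg] at this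
    have hconst := log_sub_log_const (convex_segment _ _).isPreconnected ha (hL.mono hseg)
      (fun z hz ↦ hLe z (hseg hz)) hslit (left_mem_segment ℝ _ _) (right_mem_segment ℝ _ _)
    have hinv : (a⁻¹).im < 0 := by
      rw [inv_im, neg_div]
      exact neg_neg_of_pos (div_pos haim (normSq_pos.mpr ha))
    have hleft : 0 < ((gridPt (i, m + 1) - p) / a).im := by
      have : (gridPt (i, m + 1) - p) / a = 1 - (1 / 2 : ℝ) * a⁻¹ := by
        field_simp
        apply Complex.ext <;> (simp [ha_def]; try ring)
      rw [this, sub_im, im_ofReal_mul, one_im]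
      linarith
    have hright : ((gridPt (i + 1, m + 1) - p) / a).im < 0 := by
      have : (gridPt (i + 1, m + 1) - p) / a = 1 + (1 / 2 : ℝ) * a⁻¹ := by
        field_simp
        apply Complex.ext <;> (simp [ha_def]; try ring)
      rw [this, add_im, im_ofReal_mul, one_im]
      linarith
    intro heq
    have e1 := log_neg_sub_log_of_im_pos hleft
    have e2 := log_neg_sub_log_of_im_neg hright
    simp only [div_neg] at heq
    have : (2 : ℂ) * π * I = 0 := by linear_combination e1 - e2 - heq + hconst
    exact two_pi_I_ne_zero this
  · intro u v he
    refine or_iff_not_imp_right.mpr fun hne ↦ ?_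
    refine log_sub_log_const (convex_segment (gridPt u) (gridPt v)).isPreconnected
      (neg_ne_zero.mpr ha) (hL.mono he.subset) (fun z hz ↦ hLe z (he.subset hz)) (fun z hz ↦ ?_)
      (left_mem_segment ℝ _ _) (right_mem_segment ℝ _ _)
    rw [div_neg]
    exact neg_div_mem_slitPlane ha fun t ht ↦ he.ray_avoids hpU hpre hpim hne hz ht

/-- In the upper row of the grid graph, an edge above a square not contained in `U` is separated by
a function which is constant along all other edges. -/
lemma exists_separating_function_of_square {U : Set ℂ}
    (hlog : ∀ p ∉ U, ∃ L : ℂ → ℂ, ContinuousOn L U ∧ ∀ z ∈ U, exp (L z) = z - p) {i m : ℤ} {p : ℂ}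
    (hp : p ∉ U) (hpre : p.re ∈ Icc (i : ℝ) (i + 1)) (hpim : p.im ∈ Icc (m : ℝ) (m + 1))
    (hseg : segment ℝ (gridPt (i, m + 1)) (gridPt (i + 1, m + 1)) ⊆ U) :
    ∃ D : ℤ × ℤ → ℂ, D (i, m + 1) ≠ D (i + 1, m + 1) ∧ ∀ u v, GridEdge U (m + 1) u v →
      D u = D v ∨ (u = (i, m + 1) ∧ v = (i + 1, m + 1)) ∨
        (u = (i + 1, m + 1) ∧ v = (i, m + 1)) := by
  obtain ⟨L, hL, hLe⟩ := hlog p hp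
  refine exists_separating_function hL hLe hpre ⟨hpim.1, lt_of_le_of_ne hpim.2 fun h ↦ hp ?_⟩ hseg
  refine hseg ⟨1 - (p.re - i), p.re - i, by linarith [hpre.2], by linarith [hpre.1], by ring, ?_⟩
  apply Complex.ext
  · simp; ring
  · simp [h]; ring

section

variable {U : Set ℂ} {G : Type*} [Group G] {g : ℂ → ℂ → G}

lemma cocycle_self (hg : ∀ C ⊆ U, Convex ℝ C → ∀ x ∈ C, ∀ y ∈ C, ∀ z ∈ C, g x y * g y z = g x z)
    {x : ℂ} (hx : x ∈ U) : g x x = 1 := by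
  have := hg {x} (singleton_subset_iff.mpr hx) (convex_singleton x) x rfl x rfl x rfl
  exact mul_eq_left.mp this

lemma cocycle_symm (hg : ∀ C ⊆ U, Convex ℝ C → ∀ x ∈ C, ∀ y ∈ C, ∀ z ∈ C, g x y * g y z = g x z)
    {x y : ℂ} (h : segment ℝ x y ⊆ U) : g x y * g y x = 1 := by
  rw [hg _ h (convex_segment x y) x (left_mem_segment ℝ x y) y (right_mem_segment ℝ x y) x
    (left_mem_segment ℝ x y), cocycle_self hg (h (left_mem_segment ℝ x y))]

/-- Pushing an edge down by one row, across a square contained in `U`. -/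
lemma exists_walk_push_row
    (hg : ∀ C ⊆ U, Convex ℝ C → ∀ x ∈ C, ∀ y ∈ C, ∀ z ∈ C, g x y * g y z = g x z) {m : ℤ}
    {f : ℤ × ℤ → ℤ × ℤ} (hf : ∀ u, f u = (u.1, min u.2 m)) {u v : ℤ × ℤ}
    (huv : GridEdge U (m + 1) u v)
    (hB : u.2 = m + 1 → v.2 = m + 1 → uIcc (u.1 : ℝ) v.1 ×ℂ Icc (m : ℝ) (m + 1) ⊆ U) :
    ∃ n, Walk (GridEdge U m) (fun u v ↦ g (gridPt u) (gridPt v)) (f u) (f v) n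
      ((g (gridPt u) (gridPt (f u)))⁻¹ * g (gridPt u) (gridPt v) *
        g (gridPt v) (gridPt (f v))) := by
  have hl := huv.left_le
  have hr := huv.right_le
  have hid : ∀ u : ℤ × ℤ, u.2 ≤ m → f u = u := fun u h ↦ by rw [hf, min_eq_left h]
  have hu1 := cocycle_self hg (huv.subset (left_mem_segment ℝ _ _))
  have hv1 := cocycle_self hg (huv.subset (right_mem_segment ℝ _ _))
  by_cases hum : u.2 ≤ m <;> by_cases hvm : v.2 ≤ m
  · refine ⟨1, ?_⟩
    rw [hid u hum, hid v hvm, hu1, hv1, inv_one, one_mul, mul_one]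
    exact Walk.single (g := fun u v ↦ g (gridPt u) (gridPt v)) ⟨huv.adj, hum, hvm, huv.subset⟩
  · have hfv : f v = u := by
      rw [hf]
      rcases huv.adj with ⟨h, -⟩ | ⟨h, h'⟩
      · omega
      · exact Prod.ext h.symm (show min v.2 m = u.2 by omega)
    refine ⟨0, ?_⟩
    rw [hid u hum, hfv, hu1, inv_one, one_mul, cocycle_symm hg huv.subset]
    exact Walk.nil u
  · have hfu : f u = v := by
      rw [hf]
      rcases huv.adj with ⟨h, -⟩ | ⟨h, h'⟩
      · omega
      · exact Prod.ext h (show min u.2 m = v.2 by omega)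
    refine ⟨0, ?_⟩
    rw [hid v hvm, hfu, hv1, mul_one, inv_mul_cancel]
    exact Walk.nil v
  · have hu2 : u.2 = m + 1 := by omega
    have hv2 : v.2 = m + 1 := by omega
    have hsq := hB hu2 hv2
    have hfu : f u = (u.1, m) := by rw [hf]; exact Prod.ext rfl (show min u.2 m = m by omega)
    have hfv : f v = (v.1, m) := by rw [hf]; exact Prod.ext rfl (show min v.2 m = m by omega)
    set C := uIcc (u.1 : ℝ) v.1 ×ℂ Icc (m : ℝ) (m + 1) with hC
    have hCc : Convex ℝ C := convex_reProdIm (convex_uIcc _ _) (convex_Icc _ _)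
    have m1 : gridPt u ∈ C := ⟨left_mem_uIcc, by simp [hu2]⟩
    have m2 : gridPt v ∈ C := ⟨right_mem_uIcc, by simp [hv2]⟩
    have m3 : gridPt (f u) ∈ C := by rw [hfu]; exact ⟨left_mem_uIcc, by simp⟩
    have m4 : gridPt (f v) ∈ C := by rw [hfv]; exact ⟨right_mem_uIcc, by simp⟩
    refine ⟨1, ?_⟩
    have e : (g (gridPt u) (gridPt (f u)))⁻¹ * g (gridPt u) (gridPt v) *
        g (gridPt v) (gridPt (f v)) = g (gridPt (f u)) (gridPt (f v)) := by
      rw [mul_assoc, hg C hsq hCc _ m1 _ m2 _ m4, ← hg C hsq hCc _ m1 _ m3 _ m4,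
        inv_mul_cancel_left]
    rw [e]
    refine Walk.single (g := fun u v ↦ g (gridPt u) (gridPt v))
      ⟨.inl ?_, ?_, ?_, (hCc.segment_subset m3 m4).trans hsq⟩
    · rcases huv.adj with ⟨-, h⟩ | ⟨-, h⟩
      · rw [hfu, hfv]; exact ⟨rfl, h⟩
      · omega
    · rw [hfu]
    · rw [hfv]

/-- Closed walks in the unit grid have trivial products, for a cocycle on a set whose complement is
not separated from infinity. -/
theorem walk_eq_one
    (hg : ∀ C ⊆ U, Convex ℝ C → ∀ x ∈ C, ∀ y ∈ C, ∀ z ∈ C, g x y * g y z = g x z)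
    (hlog : ∀ p ∉ U, ∃ L : ℂ → ℂ, ContinuousOn L U ∧ ∀ z ∈ U, exp (L z) = z - p) {M : ℤ}
    (hM : ∀ z ∈ U, (M : ℝ) < z.im) {m : ℤ} (hm : M ≤ m) :
    ∀ n u h, Walk (GridEdge U m) (fun u v ↦ g (gridPt u) (gridPt v)) u u n h → h = 1 := by
  induction m, hm using Int.leInduction with
  | base =>
    rintro n u h (_ | ⟨huv, -⟩)
    · rfl
    · have h1 := hM _ (huv.subset (left_mem_segment ℝ _ _))
      have h2 := huv.left_le
      rw [gridPt_im, Int.cast_lt] at h1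
      omega
  | succ m hm ihm =>
    intro n
    induction n using Nat.strong_induction_on with
    | _ n ihn =>
    intro u h W
    rcases W.push (E' := GridEdge U m) (f := fun u ↦ (u.1, min u.2 m))
      (k := fun u ↦ g (gridPt u) (gridPt (u.1, min u.2 m)))
      (B := fun u v ↦ ¬ (u.2 = m + 1 → v.2 = m + 1 →
        uIcc (u.1 : ℝ) v.1 ×ℂ Icc (m : ℝ) (m + 1) ⊆ U))
      (fun u v huv hB ↦ exists_walk_push_row hg (fun _ ↦ rfl) huv (not_not.mp hB)) with
      ⟨x, y, n₁, n₂, h₁, h₂, hxy, hB, W₁, W₂, rfl, rfl⟩ | ⟨n', W'⟩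
    · simp only [Classical.not_imp, not_subset] at hB
      obtain ⟨hx2, hy2, p, hp, hpU⟩ := hB
      have hgxy : g (gridPt y) (gridPt x) * g (gridPt x) (gridPt y) = 1 :=
        cocycle_symm hg (segment_symm ℝ (gridPt x) (gridPt y) ▸ hxy.subset)
      rcases hxy.adj with ⟨-, h | h⟩ | ⟨-, h⟩
      · have hx : x = (x.1, m + 1) := Prod.ext rfl hx2
        have hy : y = (x.1 + 1, m + 1) := Prod.ext h hy2
        obtain ⟨D, hD, hD'⟩ := exists_separating_function_of_square hlog (i := x.1) (m := m) hpU
          (by simpa [h] using hp.1) hp.2 (by rw [← hx, ← hy]; exact hxy.subset)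
        rw [← hx, ← hy] at hD hD'
        exact Walk.eq_one_of_crossing (D := D) hD' hD hgxy ihn W₁ W₂
      · have hy : y = (y.1, m + 1) := Prod.ext rfl hy2
        have hx : x = (y.1 + 1, m + 1) := Prod.ext h hx2
        obtain ⟨D, hD, hD'⟩ := exists_separating_function_of_square hlog (i := y.1) (m := m) hpU
          (by simpa [h] using hp.1) hp.2
          (by rw [← hx, ← hy, segment_symm]; exact hxy.subset)
        rw [← hx, ← hy] at hD hD'
        exact Walk.eq_one_of_crossing (D := D) (fun u v huv ↦ (hD' u v huv).imp_right Or.symm)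
          hD.symm hgxy ihn W₁ W₂
      · omega
    · have := ihm _ _ _ W'
      rw [mul_assoc, inv_mul_eq_one] at this
      exact mul_eq_right.mp this.symm

end

/-- In a path connected space, paths can be labelled by elements of the fundamental group in a
multiplicative and homotopy invariant way, such that only null-homotopic loops have the label
`1`. -/
lemma exists_holonomy {X : Type*} [TopologicalSpace X] [PathConnectedSpace X] (b : X) :
    ∃ Φ : ∀ ⦃x y : X⦄, Path x y → FundamentalGroup X b,
      (∀ ⦃x y z⦄ (p : Path x y) (q : Path y z), Φ (p.trans q) = Φ p * Φ q) ∧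
      (∀ ⦃x y⦄ (p q : Path x y), p.Homotopic q → Φ p = Φ q) ∧
      ∀ ⦃x⦄ (p : Path x x), Φ p = 1 → p.Homotopic (Path.refl x) := by
  let τ : ∀ x, Path.Homotopic.Quotient b x := fun x ↦ .mk (PathConnectedSpace.somePath b x)
  let A : ∀ ⦃x y : X⦄, Path x y → Path.Homotopic.Quotient b b := fun x y p ↦
    (τ x).trans ((Path.Homotopic.Quotient.mk p).trans (τ y).symm)
  refine ⟨fun x y p ↦ (FundamentalGroup.fromPath (A p))⁻¹, ?_, ?_, ?_⟩
  · intro x y z p q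
    have h : A (p.trans q) = (A p).trans (A q) := by
      simp only [A, Path.Homotopic.Quotient.mk_trans, Path.Homotopic.Quotient.trans_assoc]
      rw [← Path.Homotopic.Quotient.trans_assoc (τ y).symm, Path.Homotopic.Quotient.symm_trans,
        Path.Homotopic.Quotient.refl_trans]
    simp only [h, ← mul_inv_rev]
    rfl
  · intro x y p q h
    simp only [A, Path.Homotopic.Quotient.eq.mpr h]
  · intro x p h
    have h' : A p = .refl b := inv_eq_one.mp h
    have h'' : ((τ x).symm.trans (A p)).trans (τ x) = .refl x := by simp [h']
    rw [← Path.Homotopic.Quotient.eq, Path.Homotopic.Quotient.mk_refl, ← h'']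
    simp only [A, ← Path.Homotopic.Quotient.trans_assoc, Path.Homotopic.Quotient.symm_trans,
      Path.Homotopic.Quotient.refl_trans]
    simp

/-- Paths with the same endpoints in a convex subset of `U` are homotopic in `U`. -/
lemma homotopic_of_convex {U C : Set ℂ} (hCU : C ⊆ U) (hC : Convex ℝ C) {x y : U} (p q : Path x y)
    (hp : ∀ t, (p t : ℂ) ∈ C) (hq : ∀ t, (q t : ℂ) ∈ C) : p.Homotopic q := by
  have hmem : ∀ st : unitInterval × unitInterval,
      AffineMap.lineMap (p st.2 : ℂ) (q st.2 : ℂ) (st.1 : ℝ) ∈ U := fun st ↦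
    hCU (hC.lineMap_mem (hp _) (hq _) st.1.2)
  refine ⟨⟨⟨⟨fun st ↦ ⟨_, hmem st⟩, ?_⟩, ?_, ?_⟩, ?_⟩⟩
  · refine Continuous.subtype_mk ?_ _
    simp only [AffineMap.lineMap_apply_module]
    fun_prop
  · intro t; simp
  · intro t; simp
  · rintro t s (rfl | rfl) <;> simp

/-- The straight path between two points of `U`. -/
noncomputable def segPath {U : Set ℂ} (x y : U) (h : segment ℝ (x : ℂ) y ⊆ U) : Path x y where
  toFun t := ⟨AffineMap.lineMap (x : ℂ) (y : ℂ) (t : ℝ),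
    h ((convex_segment _ _).lineMap_mem (left_mem_segment ℝ _ _) (right_mem_segment ℝ _ _) t.2)⟩
  continuous_toFun := by
    refine Continuous.subtype_mk ?_ _
    simp only [AffineMap.lineMap_apply_module]
    fun_prop
  source' := by simp
  target' := by simp

lemma segPath_mem {U C : Set ℂ} (hC : Convex ℝ C) {x y : U} (h : segment ℝ (x : ℂ) y ⊆ U)
    (hx : (x : ℂ) ∈ C) (hy : (y : ℂ) ∈ C) (t : unitInterval) : (segPath x y h t : ℂ) ∈ C :=
  hC.lineMap_mem hx hy t.2

/-- Labels of paths in a plane set are given by a cocycle on short paths. -/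
lemma exists_cocycle {U : Set ℂ} {G : Type*} [Group G] (Φ : ∀ ⦃x y : U⦄, Path x y → G)
    (hmul : ∀ ⦃x y z⦄ (p : Path x y) (q : Path y z), Φ (p.trans q) = Φ p * Φ q)
    (hhom : ∀ ⦃x y⦄ (p q : Path x y), p.Homotopic q → Φ p = Φ q) :
    ∃ g : ℂ → ℂ → G,
      (∀ C ⊆ U, Convex ℝ C → ∀ x ∈ C, ∀ y ∈ C, ∀ z ∈ C, g x y * g y z = g x z) ∧
      ∀ C ⊆ U, Convex ℝ C → ∀ (x y : U) (p : Path x y), (∀ t, (p t : ℂ) ∈ C) → Φ p = g x y := by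
  classical
  let g : ℂ → ℂ → G := fun x y ↦ if h : segment ℝ x y ⊆ U then
    Φ (segPath ⟨x, h (left_mem_segment ℝ x y)⟩ ⟨y, h (right_mem_segment ℝ x y)⟩ h) else 1
  have hΦ : ∀ C ⊆ U, Convex ℝ C → ∀ (x y : U) (p : Path x y), (∀ t, (p t : ℂ) ∈ C) →
      Φ p = g x y := by
    intro C hCU hC x y p hp
    have hx : (x : ℂ) ∈ C := by simpa using hp 0
    have hy : (y : ℂ) ∈ C := by simpa using hp 1
    have h : segment ℝ (x : ℂ) y ⊆ U := (hC.segment_subset hx hy).trans hCU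
    simp only [g, dif_pos h]
    exact hhom _ _ (homotopic_of_convex hCU hC _ _ hp (segPath_mem hC h hx hy))
  refine ⟨g, fun C hCU hC x hx y hy z hz ↦ ?_, hΦ⟩
  have hxy : segment ℝ x y ⊆ U := (hC.segment_subset hx hy).trans hCU
  have hyz : segment ℝ y z ⊆ U := (hC.segment_subset hy hz).trans hCU
  let p := segPath (⟨x, hCU hx⟩ : U) ⟨y, hCU hy⟩ hxy
  let q := segPath (⟨y, hCU hy⟩ : U) ⟨z, hCU hz⟩ hyz
  have hp : ∀ t, (p t : ℂ) ∈ C := segPath_mem hC hxy hx hy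
  have hq : ∀ t, (q t : ℂ) ∈ C := segPath_mem hC hyz hy hz
  rw [← hΦ C hCU hC _ _ p hp, ← hΦ C hCU hC _ _ q hq, ← hmul]
  refine hΦ C hCU hC _ _ (p.trans q) fun t ↦ ?_
  have : p.trans q t ∈ range p ∪ range q := Path.trans_range p q ▸ mem_range_self t
  rcases this with ⟨s, hs⟩ | ⟨s, hs⟩
  · exact hs ▸ hp s
  · exact hs ▸ hq s

lemma abs_floor_sub_lt {a b : ℝ} (h : |a - b| < 1) : |(⌊a⌋ : ℝ) - b| < 2 := by
  have h1 := Int.floor_le a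
  have h2 := Int.lt_floor_add_one a
  rw [abs_lt] at h ⊢
  constructor <;> linarith

lemma floor_eq_or_of_abs_sub_lt {a b : ℝ} (h : |a - b| < 1) :
    ⌊b⌋ = ⌊a⌋ ∨ ⌊b⌋ = ⌊a⌋ + 1 ∨ ⌊a⌋ = ⌊b⌋ + 1 := by
  have h1 := Int.floor_le a
  have h2 := Int.lt_floor_add_one a
  have h3 := Int.floor_le b
  have h4 := Int.lt_floor_add_one b
  rw [abs_lt] at h
  have h5 : (⌊a⌋ : ℝ) < (⌊b⌋ + 2 : ℤ) := by push_cast; linarith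
  have h6 : (⌊b⌋ : ℝ) < (⌊a⌋ + 2 : ℤ) := by push_cast; linarith
  have h5 := Int.cast_lt.mp h5
  have h6 := Int.cast_lt.mp h6
  omega

section Chain

variable {U : Set ℂ} {G : Type*} [Group G] {g : ℂ → ℂ → G}

/-- A cocycle is trivial on closed chains of mesh at most `1` which stay away from the boundary. -/
lemma chain_eq_one
    (hg : ∀ C ⊆ U, Convex ℝ C → ∀ x ∈ C, ∀ y ∈ C, ∀ z ∈ C, g x y * g y z = g x z)
    (hlog : ∀ p ∉ U, ∃ L : ℂ → ℂ, ContinuousOn L U ∧ ∀ z ∈ U, exp (L z) = z - p)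
    (hb : Bornology.IsBounded U) {x : ℕ → ℂ} (hx : ∀ k, ball (x k) 4 ⊆ U)
    (hd : ∀ k, dist (x k) (x (k + 1)) < 1) {f : ℕ → G} (hf0 : f 0 = 1)
    (hf : ∀ k, f (k + 1) = f k * g (x k) (x (k + 1))) {n : ℕ} (hn : x n = x 0) : f n = 1 := by
  obtain ⟨R, hR0, hR⟩ := hb.exists_pos_norm_le
  have him : ∀ z ∈ U, |z.im| ≤ R := fun z hz ↦ (abs_im_le_norm z).trans (hR z hz)
  have hM : ∀ z ∈ U, ((⌊-R⌋ - 1 : ℤ) : ℝ) < z.im := fun z hz ↦ by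
    have := Int.floor_le (-R)
    have := (abs_le.mp (him z hz)).1
    push_cast
    linarith
  have hm : ⌊-R⌋ - 1 ≤ ⌈R⌉ := by
    have h1 := Int.floor_le (-R)
    have h2 := Int.le_ceil R
    have : ((⌊-R⌋ - 1 : ℤ) : ℝ) ≤ (⌈R⌉ : ℤ) := by push_cast; linarith
    exact_mod_cast this
  have hgrid : ∀ u : ℤ × ℤ, gridPt u ∈ U → u.2 ≤ ⌈R⌉ := fun u hu ↦ by
    have h1 := (abs_le.mp (him _ hu)).2
    have : (u.2 : ℝ) ≤ (⌈R⌉ : ℤ) := h1.trans (Int.le_ceil R)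
    exact_mod_cast this
  have hstep : ∀ u v : ℤ × ℤ, segment ℝ (gridPt u) (gridPt v) ⊆ U →
      (u = v ∨ (u.2 = v.2 ∧ (v.1 = u.1 + 1 ∨ u.1 = v.1 + 1)) ∨
        (u.1 = v.1 ∧ (v.2 = u.2 + 1 ∨ u.2 = v.2 + 1))) →
      ∃ l, Walk (GridEdge U ⌈R⌉) (fun u v ↦ g (gridPt u) (gridPt v)) u v l
        (g (gridPt u) (gridPt v)) := by
    rintro u v hs (rfl | h)
    · refine ⟨0, ?_⟩
      rw [cocycle_self hg (hs (left_mem_segment ℝ _ _))]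
      exact .nil u
    · exact ⟨1, Walk.single (g := fun u v ↦ g (gridPt u) (gridPt v)) ⟨h,
        hgrid _ (hs (left_mem_segment ℝ _ _)), hgrid _ (hs (right_mem_segment ℝ _ _)), hs⟩⟩
  let N : ℕ → ℤ × ℤ := fun k ↦ (⌊(x k).re⌋, ⌊(x k).im⌋)
  have hball : ∀ k (v : ℤ × ℤ), |(v.1 : ℝ) - (x k).re| < 2 → |(v.2 : ℝ) - (x k).im| < 2 →
      gridPt v ∈ ball (x k) 4 := fun k v h1 h2 ↦ by
    rw [mem_ball, dist_eq]
    refine (norm_le_abs_re_add_abs_im _).trans_lt ?_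
    simp only [sub_re, sub_im, gridPt_re, gridPt_im]
    linarith
  have hre : ∀ k, |(x (k + 1)).re - (x k).re| < 1 := fun k ↦
    (abs_re_le_norm (x (k + 1) - x k)).trans_lt (by rw [← dist_eq, dist_comm]; exact hd k)
  have him' : ∀ k, |(x (k + 1)).im - (x k).im| < 1 := fun k ↦
    (abs_im_le_norm (x (k + 1) - x k)).trans_lt (by rw [← dist_eq, dist_comm]; exact hd k)
  have hself : ∀ a : ℝ, |a - a| < 1 := by simp
  have key : ∀ k, ∃ l W, Walk (GridEdge U ⌈R⌉) (fun u v ↦ g (gridPt u) (gridPt v)) (N 0) (N k) l W ∧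
      f k = g (x 0) (gridPt (N 0)) * W * g (gridPt (N k)) (x k) := by
    intro k
    have hNk : ∀ k, gridPt (N k) ∈ ball (x k) 4 := fun k ↦
      hball k _ (abs_floor_sub_lt (hself _)) (abs_floor_sub_lt (hself _))
    induction k with
    | zero =>
      refine ⟨0, 1, .nil _, ?_⟩
      rw [hf0, mul_one, hg _ (hx 0) (convex_ball _ _) _ (mem_ball_self (by norm_num)) _ (hNk 0) _
        (mem_ball_self (by norm_num)), cocycle_self hg (hx 0 (mem_ball_self (by norm_num)))]
    | succ k ih =>
      obtain ⟨l, W, hW, hfk⟩ := ih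
      let P : ℤ × ℤ := ((N (k + 1)).1, (N k).2)
      have hP : gridPt P ∈ ball (x k) 4 :=
        hball k _ (abs_floor_sub_lt (hre k)) (abs_floor_sub_lt (hself _))
      have hN' : gridPt (N (k + 1)) ∈ ball (x k) 4 :=
        hball k _ (abs_floor_sub_lt (hre k)) (abs_floor_sub_lt (him' k))
      have hx0 : x k ∈ ball (x k) 4 := mem_ball_self (by norm_num)
      have hx1 : x (k + 1) ∈ ball (x k) 4 := by
        rw [mem_ball, dist_comm]; exact (hd k).trans (by norm_num)
      have hc := hg _ (hx k) (convex_ball (x k) 4)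
      obtain ⟨l₁, W₁⟩ := hstep (N k) P
        (((convex_ball (x k) 4).segment_subset (hNk k) hP).trans (hx k)) (by
          rcases floor_eq_or_of_abs_sub_lt (hre k) with h | h | h
          · exact .inl (Prod.ext h rfl)
          · exact .inr (.inl ⟨rfl, .inr h⟩)
          · exact .inr (.inl ⟨rfl, .inl h⟩))
      obtain ⟨l₂, W₂⟩ := hstep P (N (k + 1))
        (((convex_ball (x k) 4).segment_subset hP hN').trans (hx k)) (by
          rcases floor_eq_or_of_abs_sub_lt (him' k) with h | h | h
          · exact .inl (Prod.ext rfl h)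
          · exact .inr (.inr ⟨rfl, .inr h⟩)
          · exact .inr (.inr ⟨rfl, .inl h⟩))
      refine ⟨_, _, hW.append (W₁.append W₂), ?_⟩
      rw [hf, hfk, hc _ (hNk k) _ hP _ hN', mul_assoc, mul_assoc, mul_assoc, mul_assoc,
        hc _ (hNk k) _ hx0 _ hx1, hc _ (hNk k) _ hN' _ hx1]
  obtain ⟨l, W, hW, hfn⟩ := key n
  have hN : N n = N 0 := by simp only [N, hn]
  rw [hN] at hW hfn
  rw [walk_eq_one hg hlog hM hm _ _ _ hW, hn, mul_one] at hfn
  rw [hfn]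
  refine cocycle_symm hg (((convex_ball (x 0) 4).segment_subset (mem_ball_self (by norm_num))
    (hball 0 _ (abs_floor_sub_lt (hself _)) (abs_floor_sub_lt (hself _)))).trans (hx 0))

/-- A cocycle is trivial on closed chains of small mesh. -/
lemma chain_eq_one_of_dist_lt
    (hg : ∀ C ⊆ U, Convex ℝ C → ∀ x ∈ C, ∀ y ∈ C, ∀ z ∈ C, g x y * g y z = g x z)
    (hlog : ∀ p ∉ U, ∃ L : ℂ → ℂ, ContinuousOn L U ∧ ∀ z ∈ U, exp (L z) = z - p)
    (hb : Bornology.IsBounded U) {ε : ℝ} (hε : 0 < ε) {x : ℕ → ℂ}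
    (hx : ∀ k, ball (x k) (4 * ε) ⊆ U) (hd : ∀ k, dist (x k) (x (k + 1)) < ε) {f : ℕ → G}
    (hf0 : f 0 = 1) (hf : ∀ k, f (k + 1) = f k * g (x k) (x (k + 1))) {n : ℕ}
    (hn : x n = x 0) : f n = 1 := by
  have hε' : (ε : ℂ) ≠ 0 := by exact_mod_cast hε.ne'
  have hcancel : ∀ z : ℂ, (ε : ℂ) * (z / ε) = z := fun z ↦ mul_div_cancel₀ z hε'
  have hdist : ∀ z w : ℂ, dist (ε * z) (ε * w) = ε * dist z w := fun z w ↦ by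
    rw [dist_eq, dist_eq, ← mul_sub, norm_mul, norm_real, Real.norm_of_nonneg hε.le]
  refine chain_eq_one (U := (fun z ↦ (ε : ℂ) * z) ⁻¹' U) (g := fun z w ↦ g (ε * z) (ε * w))
    (x := fun k ↦ x k / ε) ?_ ?_ ?_ ?_ ?_ hf0 ?_ (by rw [hn])
  · intro C hCU hC a ha b hb c hc
    refine hg ((fun z ↦ (ε : ℂ) * z) '' C) (image_subset_iff.mpr hCU) ?_ _ (mem_image_of_mem _ ha) _
      (mem_image_of_mem _ hb) _ (mem_image_of_mem _ hc)
    exact hC.linear_image (LinearMap.mulLeft ℝ (ε : ℂ))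
  · intro p hp
    obtain ⟨L, hL, hLe⟩ := hlog _ hp
    refine ⟨fun z ↦ L (ε * z) - log ε, ?_, fun z hz ↦ ?_⟩
    · exact (hL.comp (by fun_prop) (mapsTo_preimage _ _)).sub continuousOn_const
    · rw [exp_sub, hLe _ hz, exp_log hε', ← mul_sub, mul_div_cancel_left₀ _ hε']
  · obtain ⟨R, hR⟩ := hb.exists_norm_le
    refine (isBounded_iff_forall_norm_le).mpr ⟨R / ε, fun z hz ↦ ?_⟩
    rw [le_div_iff₀ hε, mul_comm]
    have := hR _ hz
    rwa [norm_mul, norm_real, Real.norm_of_nonneg hε.le] at this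
  · intro k z hz
    refine hx k ?_
    rw [mem_ball] at hz ⊢
    calc dist (ε * z) (x k) = ε * dist z (x k / ε) := by rw [← hdist, hcancel]
      _ < 4 * ε := by nlinarith
  · intro k
    have := hd k
    rw [← hcancel (x k), ← hcancel (x (k + 1)), hdist] at this
    nlinarith
  · intro k
    simp only [hcancel]
    exact hf k

end Chain

/-- A bounded plane domain on which all the functions `z - p` with `p` outside of the domain have
a continuous logarithm is simply connected. -/
theorem isSimplyConnected_of_log {U : Set ℂ} (hU : IsOpen U) (hc : IsConnected U)
    (hb : Bornology.IsBounded U)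
    (hlog : ∀ p ∉ U, ∃ L : ℂ → ℂ, ContinuousOn L U ∧ ∀ z ∈ U, exp (L z) = z - p) :
    IsSimplyConnected U := by
  have hpc : PathConnectedSpace U :=
    isPathConnected_iff_pathConnectedSpace.mp (hU.isConnected_iff_isPathConnected.mp hc)
  refine simply_connected_iff_loops_nullhomotopic.mpr ⟨hpc, fun b p ↦ ?_⟩
  obtain ⟨Φ, hmul, hhom, hnull⟩ := exists_holonomy b
  obtain ⟨g, hg, hΦg⟩ := exists_cocycle Φ hmul hhom
  have hpc' : Continuous fun t ↦ (p t : ℂ) := continuous_subtype_val.comp p.continuous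
  obtain ⟨δ, hδ, hδU⟩ := (isCompact_range hpc').exists_thickening_subset_open hU
    (range_subset_iff.mpr fun t ↦ (p t).2)
  have hball : ∀ t, ball (p t : ℂ) δ ⊆ U := fun t ↦
    (ball_subset_thickening (mem_range_self t) δ).trans hδU
  obtain ⟨η, hη, hηp⟩ := Metric.uniformContinuous_iff.mp
    (CompactSpace.uniformContinuous_of_continuous hpc') (δ / 4) (by positivity)
  obtain ⟨n, hn⟩ := exists_nat_one_div_lt hη
  let t : ℕ → unitInterval := fun k ↦ projIcc 0 1 zero_le_one (k / (n + 1))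
  have ht0 : t 0 = 0 := by simp [t]
  have htn : t (n + 1) = 1 := by
    have : ((n : ℝ) + 1) / (n + 1) = 1 := div_self (by positivity)
    simp [t, this]
  have htmono : ∀ k, t k ≤ t (k + 1) := fun k ↦ monotone_projIcc _ (by gcongr; simp)
  have htd : ∀ k, dist (t k) (t (k + 1)) < η := fun k ↦ by
    refine lt_of_le_of_lt ?_ hn
    rw [Subtype.dist_eq, Real.dist_eq]
    refine (abs_projIcc_sub_projIcc zero_le_one).trans ?_
    rw [← sub_div, abs_div]
    push_cast
    rw [abs_of_pos (by positivity : (0 : ℝ) < n + 1)]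
    simp
  have hone : ∀ x, Φ (Path.refl x) = 1 := fun x ↦ by
    have := hmul (Path.refl x) (Path.refl x)
    rw [Path.refl_trans_refl] at this
    exact left_eq_mul.mp this
  have hsub : Φ (p.subpath (t 0) (t (n + 1))) = 1 := by
    refine chain_eq_one_of_dist_lt hg hlog hb (ε := δ / 4) (by positivity)
      (x := fun k ↦ (p (t k) : ℂ)) (f := fun k ↦ Φ (p.subpath (t 0) (t k))) (n := n + 1)
      (fun k ↦ ?_) (fun k ↦ hηp (htd k)) ?_ (fun k ↦ ?_) ?_
    · rw [mul_div_cancel₀ _ (by norm_num)]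
      exact hball _
    · rw [Path.subpath_self, hone]
    · rw [← hΦg _ (hball (t k)) (convex_ball _ _) _ _ (p.subpath (t k) (t (k + 1))) ?_, ← hmul]
      · exact (hhom _ _ ⟨Path.Homotopy.subpathTransSubpath p _ _ _⟩).symm
      · intro s
        have : p.subpath (t k) (t (k + 1)) s ∈ p '' Icc (t k) (t (k + 1)) :=
          Path.range_subpath_of_le p _ _ (htmono k) ▸ mem_range_self s
        obtain ⟨r, hr, hrs⟩ := this
        rw [← hrs, mem_ball]
        refine (hηp ?_).trans (by linarith)
        refine lt_of_le_of_lt ?_ (htd k)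
        rw [Subtype.dist_eq, Subtype.dist_eq, Real.dist_eq, Real.dist_eq, abs_sub_comm (t k : ℝ)]
        have h1 : (t k : ℝ) ≤ r := hr.1
        have h2 : (r : ℝ) ≤ t (k + 1) := hr.2
        exact abs_le_abs_of_nonneg (by linarith) (by linarith)
    · simp [ht0, htn]
  have hcast : ∀ {x y x' y' : U} (q : Path x y) (hx : x' = x) (hy : y' = y),
      Φ (q.cast hx hy) = Φ q := by
    rintro x y _ _ q rfl rfl
    rfl
  rw [ht0, htn, Path.subpath_zero_one, hcast] at hsub
  exact hnull p hsub

/-- A crosscut of a bounded simply connected domain in `ℂ` splits it into two simply connected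
domains. -/
theorem crosscut_splits {Ω : Set ℂ} {γ : ℝ → ℂ} (hΩb : Bornology.IsBounded Ω) (hΩo : IsOpen Ω)
    (hΩ : IsSimplyConnected Ω) (hγc : ContinuousOn γ (Icc 0 1)) (hγi : InjOn γ (Icc 0 1))
    (hγΩ : ∀ t ∈ Ioo (0 : ℝ) 1, γ t ∈ Ω) (hγ0 : γ 0 ∉ Ω) (hγ1 : γ 1 ∉ Ω) :
    ∃ U V, IsOpen U ∧ IsOpen V ∧ IsConnected U ∧ IsConnected V ∧ Disjoint U V ∧
      U ∪ V = Ω \ γ '' Ioo 0 1 ∧ IsSimplyConnected U ∧ IsSimplyConnected V := by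
  obtain ⟨U, V, hU, hV, hUc, hVc, hUV, hW⟩ :=
    crosscut_two_components hΩo hΩ hγc hγi hγΩ hγ0 hγ1
  have hsc : ∀ U V : Set ℂ, IsOpen U → IsOpen V → IsConnected U → Disjoint U V →
      U ∪ V = Ω \ γ '' Icc 0 1 → IsSimplyConnected U := by
    intro U V hU hV hUc hUV hW
    have hUΩ : U ⊆ Ω := (subset_union_left.trans hW.subset).trans sdiff_subset
    refine isSimplyConnected_of_log hU hUc (hΩb.subset hUΩ) fun p hp ↦ ?_
    obtain ⟨q, hq, hpq⟩ :=
      exists_joinedIn_compl_of_crosscut hΩ.isPathConnected hγc hγΩ hγ1 hU hV hUV hW hp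
    exact exists_log_of_joinedIn hΩo hΩ hUΩ hpq hq
  refine ⟨U, V, hU, hV, hUc, hVc, hUV, hW.trans ?_, hsc U V hU hV hUc hUV hW,
    hsc V U hV hU hVc hUV.symm (union_comm U V ▸ hW)⟩
  refine Subset.antisymm (sdiff_subset_sdiff_right (image_mono Ioo_subset_Icc_self)) ?_
  rintro z ⟨hz, hzγ⟩
  refine ⟨hz, ?_⟩
  rintro ⟨t, ht, rfl⟩
  rcases ht.1.eq_or_lt with rfl | h0
  · exact hγ0 hz
  rcases ht.2.eq_or_lt with rfl | h1
  · exact hγ1 hz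
  exact hzγ ⟨t, ⟨h0, h1⟩, rfl⟩

end Crosscut

/-- A crosscut of a bounded simply connected plane domain (an open Jordan arc in `Ω`
whose endpoints lie on `∂Ω`) splits it into exactly two simply connected domains. -/
theorem crosscut_splits_simply_connected_domain
    (Ω : Set (EuclideanSpace ℝ (Fin 2))) (hΩne : Ω.Nonempty)
    (hΩb : Bornology.IsBounded Ω) (hΩo : IsOpen Ω) (hΩsc : SimplyConnectedSpace Ω)
    (γ : ℝ → EuclideanSpace ℝ (Fin 2))
    (hγc : ContinuousOn γ (Icc 0 1)) (hγi : InjOn γ (Icc 0 1))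
    (hγΩ : ∀ t ∈ Ioo (0:ℝ) 1, γ t ∈ Ω)
    (hγ0 : γ 0 ∈ frontier Ω) (hγ1 : γ 1 ∈ frontier Ω) :
    ∃ U V : Set (EuclideanSpace ℝ (Fin 2)),
      IsOpen U ∧ IsOpen V ∧ U.Nonempty ∧ V.Nonempty ∧
      IsConnected U ∧ IsConnected V ∧ Disjoint U V ∧
      U ∪ V = Ω \ (γ '' Ioo 0 1) ∧
      SimplyConnectedSpace U ∧ SimplyConnectedSpace V := by
  let e := Complex.orthonormalBasisOneI.repr
  let h := e.toHomeomorph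
  have hsymm : ∀ x, h (e.symm x) = x := e.apply_symm_apply
  have hmem : ∀ x, e.symm x ∈ h ⁻¹' Ω ↔ x ∈ Ω := fun x ↦ by rw [mem_preimage, hsymm]
  have hfr : ∀ x ∈ frontier Ω, e.symm x ∉ h ⁻¹' Ω := fun x hx hxΩ ↦
    (hΩo.frontier_eq ▸ hx).2 ((hmem x).mp hxΩ)
  obtain ⟨U, V, hU, hV, hUc, hVc, hUV, hW, hUs, hVs⟩ :=
    Crosscut.crosscut_splits (Ω := h ⁻¹' Ω) (γ := fun t ↦ e.symm (γ t))
      (e.isometry.antilipschitz.isBounded_preimage hΩb) (hΩo.preimage h.continuous)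
      (h.isSimplyConnected_preimage.mpr hΩsc) (e.symm.continuous.comp_continuousOn hγc)
      (e.symm.injective.comp_injOn hγi) (fun t ht ↦ (hmem _).mpr (hγΩ t ht)) (hfr _ hγ0)
      (hfr _ hγ1)
  refine ⟨h '' U, h '' V, h.isOpenMap U hU, h.isOpenMap V hV, hUc.nonempty.image h,
    hVc.nonempty.image h, hUc.image h h.continuous.continuousOn,
    hVc.image h h.continuous.continuousOn, (disjoint_image_iff h.injective).mpr hUV, ?_,
    h.isSimplyConnected_image.mpr hUs, h.isSimplyConnected_image.mpr hVs⟩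
  rw [← image_union, hW, image_sdiff h.injective, image_preimage_eq _ h.surjective, image_image]
  simp only [hsymm]
end

section
/- Let 1 < p < ∞, let Ω ⊆ ℝ² be a nonempty bounded open simply connected set, and let Φ : closure(Ω) → ℝ be continuous on closure(Ω) and C¹ on Ω with ∫_Ω ‖∇Φ(x)‖^p dx < ∞. Let φ : closure(Ω) → ℝ be continuous on closure(Ω), p-harmonic on Ω, and equal to Φ on the frontier of Ω. Then ∫_Ω ‖∇φ(x)‖^p dx ≤ ∫_Ω ‖∇Φ(x)‖^p dx, and equality holds if and only if φ = Φ on closure(Ω). -/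
open MeasureTheory Set
open scoped RealInnerProductSpace

/-- `φ` is `p`-harmonic on the open set `Ω ⊆ ℝ²`: it is `C¹` on `Ω` and satisfies the
weak form of `div(‖∇φ‖^{p-2} ∇φ) = 0` against all compactly supported `C¹` test
functions supported in `Ω`. -/
def PHarmonicOn (p : ℝ) (Ω : Set (EuclideanSpace ℝ (Fin 2)))
    (φ : EuclideanSpace ℝ (Fin 2) → ℝ) : Prop :=
  ContDiffOn ℝ 1 φ Ω ∧
  ∀ η : EuclideanSpace ℝ (Fin 2) → ℝ, ContDiff ℝ 1 η → HasCompactSupport η →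
    tsupport η ⊆ Ω →
    ∫ x in Ω, ‖gradient φ x‖ ^ (p - 2) * ⟪gradient φ x, gradient η x⟫ = 0

open Filter Topology

namespace PHarmonicEnergy

section Bregman

theorem norm_rpow_mul_sq {E : Type*} [NormedAddCommGroup E] {p : ℝ} {a : E} (ha : a ≠ 0) :
    ‖a‖ ^ (p - 2) * ‖a‖ ^ 2 = ‖a‖ ^ p := by
  rw [← Real.rpow_natCast, ← Real.rpow_add (norm_pos_iff.2 ha)]
  norm_num

variable {E : Type*} [NormedAddCommGroup E] [InnerProductSpace ℝ E]

/-- The Bregman divergence of `‖·‖ ^ p`. -/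
noncomputable def bregman (p : ℝ) (a b : E) : ℝ :=
  ‖b‖ ^ p - ‖a‖ ^ p - p * (‖a‖ ^ (p - 2) * ⟪a, b - a⟫)

theorem bregman_eq_add {p : ℝ} {a : E} (ha : a ≠ 0) (b : E) :
    bregman p a b = ‖a‖ ^ p * ((‖b‖ / ‖a‖) ^ p - (1 + p * (‖b‖ / ‖a‖ - 1))) +
      p * (‖a‖ ^ (p - 2) * (‖a‖ * ‖b‖ - ⟪a, b⟫)) := by
  have h0 : ‖a‖ ≠ 0 := norm_ne_zero_iff.2 ha
  have h1 : ‖a‖ ^ p * (‖b‖ / ‖a‖) ^ p = ‖b‖ ^ p := by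
    rw [← Real.mul_rpow (norm_nonneg a) (by positivity), mul_div_cancel₀ _ h0]
  have h2 : ‖a‖ ^ p * (‖b‖ / ‖a‖) = ‖a‖ ^ (p - 2) * (‖a‖ * ‖b‖) := by
    rw [← norm_rpow_mul_sq ha]
    field_simp
  have h3 := norm_rpow_mul_sq (p := p) ha
  rw [bregman, inner_sub_right, real_inner_self_eq_norm_sq]
  linear_combination (-1 : ℝ) * h1 + p * h2 + p * h3

theorem bregman_nonneg {p : ℝ} (hp : 1 < p) (a b : E) : 0 ≤ bregman p a b := by
  by_cases ha : a = 0
  · simp only [bregman, ha, norm_zero, inner_zero_left, mul_zero, sub_zero,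
      Real.zero_rpow (by linarith : p ≠ 0)]
    positivity
  · rw [bregman_eq_add ha]
    have h1 := one_add_mul_self_le_rpow_one_add (s := ‖b‖ / ‖a‖ - 1)
      (by linarith [show 0 ≤ ‖b‖ / ‖a‖ by positivity]) hp.le
    rw [add_sub_cancel] at h1
    have h2 := real_inner_le_norm a b
    have h3 := sub_nonneg.2 h1
    have h4 := sub_nonneg.2 h2
    positivity

theorem eq_of_bregman_eq_zero {p : ℝ} (hp : 1 < p) {a b : E} (h : bregman p a b = 0) :
    a = b := by
  by_cases ha : a = 0
  · simp only [bregman, ha, norm_zero, inner_zero_left, mul_zero, sub_zero,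
      Real.zero_rpow (by linarith : p ≠ 0)] at h
    rw [Real.rpow_eq_zero (norm_nonneg b) (by linarith), norm_eq_zero] at h
    rw [ha, h]
  · have hpos : 0 < ‖a‖ := norm_pos_iff.2 ha
    rw [bregman_eq_add ha] at h
    have hs : -1 ≤ ‖b‖ / ‖a‖ - 1 := by linarith [show 0 ≤ ‖b‖ / ‖a‖ by positivity]
    have h1 := one_add_mul_self_le_rpow_one_add hs hp.le
    rw [add_sub_cancel] at h1
    have h2 := sub_nonneg.2 (real_inner_le_norm a b)
    have h3 := sub_nonneg.2 h1
    have hnorm : ‖b‖ / ‖a‖ - 1 = 0 := by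
      by_contra hne
      have h4 := one_add_mul_self_lt_rpow_one_add hs hne hp
      rw [add_sub_cancel] at h4
      have h5 := sub_pos.2 h4
      have : 0 < ‖a‖ ^ p * ((‖b‖ / ‖a‖) ^ p - (1 + p * (‖b‖ / ‖a‖ - 1))) := by positivity
      have : 0 ≤ p * (‖a‖ ^ (p - 2) * (‖a‖ * ‖b‖ - ⟪a, b⟫)) := by positivity
      linarith
    have hinner : ‖a‖ * ‖b‖ - ⟪a, b⟫ = 0 := by
      by_contra hne
      have h5 := h2.lt_of_ne' hne
      have : 0 ≤ ‖a‖ ^ p * ((‖b‖ / ‖a‖) ^ p - (1 + p * (‖b‖ / ‖a‖ - 1))) := by positivity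
      have : 0 < p * (‖a‖ ^ (p - 2) * (‖a‖ * ‖b‖ - ⟪a, b⟫)) := by positivity
      linarith
    have hab : ‖b‖ = ‖a‖ := by
      rwa [sub_eq_zero, div_eq_one_iff_eq hpos.ne'] at hnorm
    have hsq : ‖a - b‖ ^ 2 = 0 := by
      rw [norm_sub_sq_real]
      rw [hab] at hinner ⊢
      linear_combination 2 * hinner
    exact sub_eq_zero.1 (norm_eq_zero.1 (pow_eq_zero_iff two_ne_zero |>.1 hsq))

theorem abs_norm_rpow_mul_inner_le {p : ℝ} (hp : 1 < p) (a b : E) :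
    |‖a‖ ^ (p - 2) * ⟪a, b⟫| ≤ ‖a‖ ^ (p - 1) * ‖b‖ := by
  by_cases ha : a = 0
  · simp [ha, Real.zero_rpow (by linarith : p - 1 ≠ 0)]
  · have hpos : 0 < ‖a‖ := norm_pos_iff.2 ha
    have h1 : ‖a‖ ^ (p - 1) = ‖a‖ ^ (p - 2) * ‖a‖ := by
      rw [← Real.rpow_add_one hpos.ne']
      ring_nf
    rw [abs_mul, abs_of_nonneg (by positivity), h1, mul_assoc]
    gcongr
    exact abs_real_inner_le_norm a b

end Bregman

section Truncation

/-- A continuous cutoff with values in `[0, 1]`, vanishing for `n * |t| ≤ 1` and equal to `1` for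
`2 ≤ n * |t|`. -/
noncomputable def cutoff (n : ℕ) (t : ℝ) : ℝ := max 0 (min 1 (n * |t| - 1))

theorem continuous_cutoff (n : ℕ) : Continuous (cutoff n) := by
  unfold cutoff
  fun_prop

theorem cutoff_nonneg (n : ℕ) (t : ℝ) : 0 ≤ cutoff n t := le_max_left _ _

theorem cutoff_le_one (n : ℕ) (t : ℝ) : cutoff n t ≤ 1 :=
  max_le zero_le_one (min_le_left _ _)

theorem cutoff_eq_zero {n : ℕ} {t : ℝ} (h : n * |t| ≤ 1) : cutoff n t = 0 :=
  max_eq_left ((min_le_right _ _).trans (by linarith))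

theorem cutoff_mono (t : ℝ) : Monotone fun n => cutoff n t := by
  intro m n hmn
  have : (m : ℝ) ≤ n := by exact_mod_cast hmn
  exact max_le_max le_rfl (min_le_min le_rfl (by gcongr))

theorem eventually_cutoff_eq_one {t : ℝ} (ht : t ≠ 0) : ∀ᶠ n in atTop, cutoff n t = 1 := by
  have h : Tendsto (fun n : ℕ => (n : ℝ) * |t|) atTop atTop :=
    tendsto_natCast_atTop_atTop.atTop_mul_const (abs_pos.2 ht)
  filter_upwards [h.eventually_ge_atTop 2] with n hn
  rw [cutoff, min_eq_left (by linarith), max_eq_right zero_le_one]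

theorem tendsto_cutoff_mul (t c : ℝ) (h : t = 0 → c = 0) :
    Tendsto (fun n => cutoff n t * c) atTop (𝓝 c) := by
  by_cases ht : t = 0
  · simp [h ht]
  · refine tendsto_const_nhds.congr' ?_
    filter_upwards [eventually_cutoff_eq_one ht] with n hn
    rw [hn, one_mul]

/-- The primitive of `cutoff n` vanishing at the origin. -/
noncomputable def truncation (n : ℕ) (s : ℝ) : ℝ := ∫ t in (0 : ℝ)..s, cutoff n t

theorem hasDerivAt_truncation (n : ℕ) (s : ℝ) : HasDerivAt (truncation n) (cutoff n s) s :=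
  (continuous_cutoff n).integral_hasStrictDerivAt 0 s |>.hasDerivAt

theorem contDiff_truncation (n : ℕ) : ContDiff ℝ 1 (truncation n) := by
  rw [contDiff_one_iff_deriv]
  refine ⟨fun s => (hasDerivAt_truncation n s).differentiableAt, ?_⟩
  rw [show deriv (truncation n) = cutoff n from funext fun s => (hasDerivAt_truncation n s).deriv]
  exact continuous_cutoff n

theorem truncation_eq_zero {n : ℕ} {s : ℝ} (h : n * |s| ≤ 1) : truncation n s = 0 := by
  rw [truncation, intervalIntegral.integral_congr (g := fun _ => (0 : ℝ))]
  · simp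
  · intro t ht
    have hts : |t| ≤ |s| := by simpa using abs_sub_left_of_mem_uIcc ht
    exact cutoff_eq_zero ((mul_le_mul_of_nonneg_left hts n.cast_nonneg).trans h)

theorem cutoff_mul_bregman {E : Type*} [NormedAddCommGroup E] [InnerProductSpace ℝ E]
    (n : ℕ) (p t : ℝ) (a b : E) :
    cutoff n t * bregman p a b = (cutoff n t * ‖b‖ ^ p - cutoff n t * ‖a‖ ^ p) -
      p * (cutoff n t * (‖a‖ ^ (p - 2) * ⟪a, b - a⟫)) := by
  rw [bregman]
  ring

end Truncation

section Analysis

theorem integrable_of_tendsto_of_integral_le {α : Type*} [MeasurableSpace α] {μ : Measure α}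
    {G : ℕ → α → ℝ} {f : α → ℝ} {C : ℝ} (hG : ∀ n, Integrable (G n) μ)
    (hG0 : ∀ n, 0 ≤ᵐ[μ] G n) (hC : ∀ n, ∫ x, G n x ∂μ ≤ C)
    (hlim : ∀ᵐ x ∂μ, Tendsto (fun n => G n x) atTop (𝓝 (f x))) : Integrable f μ := by
  refine ⟨aestronglyMeasurable_of_tendsto_ae _ (fun n => (hG n).1) hlim, ?_⟩
  have h1 : ∫⁻ x, ‖f x‖ₑ ∂μ ≤ liminf (fun n => ∫⁻ x, ‖G n x‖ₑ ∂μ) atTop :=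
    lintegral_congr_ae (by filter_upwards [hlim] with x hx using hx.enorm.liminf_eq) ▸
      lintegral_liminf_le' fun n => (hG n).1.enorm
  have h2 : ∀ n, ∫⁻ x, ‖G n x‖ₑ ∂μ ≤ ENNReal.ofReal C := fun n => by
    have : ∫⁻ x, ‖G n x‖ₑ ∂μ = ∫⁻ x, ENNReal.ofReal (G n x) ∂μ :=
      lintegral_congr_ae (by filter_upwards [hG0 n] with x hx using Real.enorm_of_nonneg hx)
    rw [this, ← ofReal_integral_eq_lintegral_ofReal (hG n) (hG0 n)]
    exact ENNReal.ofReal_le_ofReal (hC n)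
  exact (h1.trans (liminf_le_of_frequently_le' (Frequently.of_forall h2))).trans_lt
    ENNReal.ofReal_lt_top

variable {E : Type*} [NormedAddCommGroup E] [InnerProductSpace ℝ E]

theorem continuousOn_gradient [CompleteSpace E] {f : E → ℝ} {Ω : Set E} (hΩ : IsOpen Ω)
    (hf : ContDiffOn ℝ 1 f Ω) : ContinuousOn (gradient f) Ω :=
  (InnerProductSpace.toDual ℝ E).symm.continuous.comp_continuousOn
    (hf.continuousOn_fderiv_of_isOpen hΩ le_rfl)

theorem gradient_eq_iff_fderiv_eq [CompleteSpace E] {f g : E → ℝ} {x : E} :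
    gradient f x = gradient g x ↔ fderiv ℝ f x = fderiv ℝ g x :=
  (InnerProductSpace.toDual ℝ E).symm.injective.eq_iff

theorem eqOn_closure_of_eqOn_gradient [CompleteSpace E] [Nontrivial E] {f g : E → ℝ} {Ω : Set E}
    (hΩne : Ω.Nonempty) (hΩb : Bornology.IsBounded Ω) (hΩo : IsOpen Ω) (hΩc : IsPreconnected Ω)
    (hfc : ContinuousOn f (closure Ω)) (hgc : ContinuousOn g (closure Ω))
    (hf : DifferentiableOn ℝ f Ω) (hg : DifferentiableOn ℝ g Ω)
    (hgrad : EqOn (gradient f) (gradient g) Ω) (hfg : EqOn f g (frontier Ω)) :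
    EqOn f g (closure Ω) := by
  obtain ⟨a, ha⟩ := hΩo.exists_eq_add_of_fderiv_eq hΩc hf hg
    fun x hx => gradient_eq_iff_fderiv_eq.1 (hgrad hx)
  have hcl : EqOn f (fun x => g x + a) (closure Ω) :=
    ha.of_subset_closure hfc (hgc.add continuousOn_const) subset_closure subset_rfl
  obtain ⟨y, hy⟩ : (frontier Ω).Nonempty := by
    refine nonempty_frontier_iff.2 ⟨hΩne, fun h => ?_⟩
    exact NormedSpace.unbounded_univ ℝ E (h ▸ hΩb)
  have ha0 : a = 0 := by
    have h1 := hcl (frontier_subset_closure hy)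
    rw [hfg hy] at h1
    simpa using h1
  simpa [ha0] using hcl

variable [FiniteDimensional ℝ E] [MeasurableSpace E] [BorelSpace E]

/-- The derivative of a function vanishes almost everywhere on its zero set. -/
theorem ae_fderiv_eq_zero_of_eq_zero (μ : Measure E) [μ.IsAddHaarMeasure] {u : E → ℝ} {s : Set E}
    (hs : MeasurableSet s) (hu : ∀ x ∈ s, DifferentiableAt ℝ u x) (hu0 : ∀ x ∈ s, u x = 0) :
    ∀ᵐ x ∂μ.restrict s, fderiv ℝ u x = 0 := by
  rcases subsingleton_or_nontrivial E with hE | hE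
  · exact Eventually.of_forall fun x => ContinuousLinearMap.ext fun v => by
      rw [Subsingleton.elim v 0, map_zero, map_zero]
  obtain ⟨v, hv⟩ := exists_ne (0 : E)
  have happrox : ApproximatesLinearOn (fun x => u x • v) (0 : E →L[ℝ] E) s 0 := by
    intro x hx y hy
    simp [hu0 x hx, hu0 y hy]
  filter_upwards [happrox.norm_fderiv_sub_le μ hs (fun x => (fderiv ℝ u x).smulRight v)
    fun x hx => ((hu x hx).hasFDerivAt.smul_const v).hasFDerivWithinAt] with x hx
  simpa [hv] using hx

theorem ae_gradient_eq_of_eq (μ : Measure E) [μ.IsAddHaarMeasure] {f g : E → ℝ} {Ω : Set E}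
    (hΩ : IsOpen Ω) (hf : DifferentiableOn ℝ f Ω) (hg : DifferentiableOn ℝ g Ω) :
    ∀ᵐ x ∂μ.restrict Ω, f x = g x → gradient f x = gradient g x := by
  have hd : ∀ x ∈ Ω, DifferentiableAt ℝ f x ∧ DifferentiableAt ℝ g x := fun x hx =>
    ⟨hf.differentiableAt (hΩ.mem_nhds hx), hg.differentiableAt (hΩ.mem_nhds hx)⟩
  have hmeas : MeasurableSet (Ω ∩ (fun x => f x - g x) ⁻¹' {0}) := by
    have hdiff : Ω ∩ (fun x => f x - g x) ⁻¹' {0} =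
        Ω \ (Ω ∩ (fun x => f x - g x) ⁻¹' {0}ᶜ) := by
      ext x; simp
    rw [hdiff]
    exact hΩ.measurableSet.diff ((hf.continuousOn.sub hg.continuousOn).isOpen_inter_preimage hΩ
      isOpen_compl_singleton).measurableSet
  have h := ae_fderiv_eq_zero_of_eq_zero μ (u := fun x => f x - g x) hmeas
    (fun x hx => (hd x hx.1).1.sub (hd x hx.1).2) fun x hx => hx.2
  rw [ae_restrict_iff' hmeas] at h
  rw [ae_restrict_iff' hΩ.measurableSet]
  filter_upwards [h] with x hx hxΩ hfg
  have := hx ⟨hxΩ, by simp [hfg]⟩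
  rw [fderiv_fun_sub (hd x hxΩ).1 (hd x hxΩ).2, sub_eq_zero] at this
  exact gradient_eq_iff_fderiv_eq.2 this

end Analysis

section Dirichlet

variable {E : Type*} [NormedAddCommGroup E] {Ω : Set E} {f g : E → ℝ}

/-- The set where two functions with the same boundary values are at distance at least `1 / n`. -/
def gapSet (Ω : Set E) (f g : E → ℝ) (n : ℕ) : Set E :=
  {x ∈ closure Ω | 1 ≤ n * |f x - g x|}

theorem isCompact_gapSet [ProperSpace E] (hΩb : Bornology.IsBounded Ω)
    (hf : ContinuousOn f (closure Ω)) (hg : ContinuousOn g (closure Ω)) (n : ℕ) :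
    IsCompact (gapSet Ω f g n) := by
  refine hΩb.isCompact_closure.of_isClosed_subset ?_ fun x hx => hx.1
  exact isClosed_closure.isClosed_le continuousOn_const
    (continuousOn_const.mul (hf.sub hg).abs)

theorem gapSet_subset (hΩo : IsOpen Ω) (hfg : EqOn f g (frontier Ω)) (n : ℕ) :
    gapSet Ω f g n ⊆ Ω := by
  rintro x ⟨hx, hx1⟩
  by_contra hxΩ
  have := hfg (show x ∈ frontier Ω from ⟨hx, by rwa [hΩo.interior_eq]⟩)
  norm_num [this] at hx1

theorem mul_abs_le_one_of_notMem_gapSet {n : ℕ} {x : E} (hx : x ∈ Ω) (hxK : x ∉ gapSet Ω f g n) :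
    n * |f x - g x| ≤ 1 := by
  by_contra h
  exact hxK ⟨subset_closure hx, (not_le.1 h).le⟩

/-- The truncation of `f - g`, extended by zero outside `Ω`. -/
noncomputable def truncatedGap (Ω : Set E) (f g : E → ℝ) (n : ℕ) : E → ℝ :=
  Ω.indicator fun x => truncation n (f x - g x)

theorem support_truncatedGap_subset (n : ℕ) :
    Function.support (truncatedGap Ω f g n) ⊆ gapSet Ω f g n := by
  intro x hx
  by_contra hxK
  refine hx ?_
  by_cases hxΩ : x ∈ Ω
  · rw [truncatedGap, indicator_of_mem hxΩ,
      truncation_eq_zero (mul_abs_le_one_of_notMem_gapSet hxΩ hxK)]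
  · exact indicator_of_notMem hxΩ _

theorem truncatedGap_eventuallyEq (hΩo : IsOpen Ω) {x : E} (hx : x ∈ Ω) (n : ℕ) :
    truncatedGap Ω f g n =ᶠ[𝓝 x] fun y => truncation n (f y - g y) := by
  filter_upwards [hΩo.mem_nhds hx] with y hy using indicator_of_mem hy _

theorem tsupport_truncatedGap_subset {n : ℕ} (hK : IsCompact (gapSet Ω f g n)) :
    tsupport (truncatedGap Ω f g n) ⊆ gapSet Ω f g n :=
  closure_minimal (support_truncatedGap_subset n) hK.isClosed

theorem contDiff_truncatedGap [NormedSpace ℝ E] {n : ℕ} (hΩo : IsOpen Ω)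
    (hK : IsCompact (gapSet Ω f g n)) (hKΩ : gapSet Ω f g n ⊆ Ω)
    (hf : ContDiffOn ℝ 1 f Ω) (hg : ContDiffOn ℝ 1 g Ω) :
    ContDiff ℝ 1 (truncatedGap Ω f g n) := by
  rw [contDiff_iff_contDiffAt]
  intro x
  by_cases hx : x ∈ gapSet Ω f g n
  · have hxΩ := hKΩ hx
    refine ContDiffAt.congr_of_eventuallyEq ?_ (truncatedGap_eventuallyEq hΩo hxΩ n)
    exact (contDiff_truncation n).contDiffAt.comp x
      ((hf.contDiffAt (hΩo.mem_nhds hxΩ)).sub (hg.contDiffAt (hΩo.mem_nhds hxΩ)))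
  · refine (contDiffAt_const (c := (0 : ℝ))).congr_of_eventuallyEq ?_
    filter_upwards [hK.isClosed.isOpen_compl.mem_nhds hx] with y hy
    by_contra h
    exact hy (support_truncatedGap_subset n h)

theorem gradient_truncatedGap [InnerProductSpace ℝ E] [CompleteSpace E]
    (hΩo : IsOpen Ω) (hf : DifferentiableOn ℝ f Ω) (hg : DifferentiableOn ℝ g Ω)
    (n : ℕ) {x : E} (hx : x ∈ Ω) :
    gradient (truncatedGap Ω f g n) x = cutoff n (f x - g x) • (gradient f x - gradient g x) := by
  have hfx := (hf.differentiableAt (hΩo.mem_nhds hx)).hasFDerivAt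
  have hgx := (hg.differentiableAt (hΩo.mem_nhds hx)).hasFDerivAt
  have h := ((hasDerivAt_truncation n (f x - g x)).comp_hasFDerivAt x
    (hfx.sub hgx)).congr_of_eventuallyEq (truncatedGap_eventuallyEq hΩo hx n)
  rw [gradient, h.fderiv, map_smul, map_sub, gradient, gradient]

variable [MeasurableSpace E] [BorelSpace E] {μ : Measure E} [IsFiniteMeasureOnCompacts μ]

theorem integrableOn_cutoff_mul {n : ℕ} {h : E → ℝ} (hΩo : IsOpen Ω)
    (hK : IsCompact (gapSet Ω f g n)) (hKΩ : gapSet Ω f g n ⊆ Ω) (hf : ContinuousOn f Ω)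
    (hg : ContinuousOn g Ω) (hh : ContinuousOn h Ω) :
    IntegrableOn (fun x => cutoff n (f x - g x) * h x) Ω μ := by
  have hcont : ContinuousOn (fun x => cutoff n (f x - g x) * h x) Ω :=
    ((continuous_cutoff n).comp_continuousOn (hf.sub hg)).mul hh
  refine IntegrableOn.of_forall_sdiff_eq_zero ((hcont.mono hKΩ).integrableOn_compact hK)
    hΩo.measurableSet fun x hx => ?_
  rw [cutoff_eq_zero (mul_abs_le_one_of_notMem_gapSet hx.1 hx.2), zero_mul]

variable [InnerProductSpace ℝ E] [FiniteDimensional ℝ E]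

theorem integrableOn_cutoff_mul_flux {n : ℕ} {p : ℝ} (hp : 1 < p) (hΩo : IsOpen Ω)
    (hK : IsCompact (gapSet Ω f g n)) (hKΩ : gapSet Ω f g n ⊆ Ω) (hf : ContDiffOn ℝ 1 f Ω)
    (hg : ContDiffOn ℝ 1 g Ω) :
    IntegrableOn (fun x => cutoff n (f x - g x) *
      (‖gradient f x‖ ^ (p - 2) * ⟪gradient f x, gradient g x - gradient f x⟫)) Ω μ := by
  have hf' := continuousOn_gradient hΩo hf
  have hg' := continuousOn_gradient hΩo hg
  have hbound := integrableOn_cutoff_mul (μ := μ) hΩo hK hKΩ hf.continuousOn hg.continuousOn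
    ((hf'.norm.rpow_const fun x _ => Or.inr (by linarith : 0 ≤ p - 1)).mul (hg'.sub hf').norm)
  refine Integrable.mono' hbound ?_ (Eventually.of_forall fun x => ?_)
  · have hcut := ((continuous_cutoff n).comp_continuousOn
      (hf.continuousOn.sub hg.continuousOn)).aestronglyMeasurable (μ := μ) hΩo.measurableSet
    have hnorm := hf'.norm.aestronglyMeasurable (μ := μ) hΩo.measurableSet
    have hinner := (hf'.inner (𝕜 := ℝ) (hg'.sub hf')).aestronglyMeasurable (μ := μ)
      hΩo.measurableSet
    exact hcut.mul ((hnorm.aemeasurable.pow_const (p - 2)).aestronglyMeasurable.mul hinner)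
  · rw [Real.norm_eq_abs, abs_mul, abs_of_nonneg (cutoff_nonneg _ _)]
    exact mul_le_mul_of_nonneg_left (abs_norm_rpow_mul_inner_le hp _ _) (cutoff_nonneg _ _)

theorem integrableOn_cutoff_mul_norm_rpow {n : ℕ} {p : ℝ} (hp : 1 < p) (hΩo : IsOpen Ω)
    (hK : IsCompact (gapSet Ω f g n)) (hKΩ : gapSet Ω f g n ⊆ Ω) (hf : ContinuousOn f Ω)
    (hg : ContinuousOn g Ω) {h : E → ℝ} (hh : ContDiffOn ℝ 1 h Ω) :
    IntegrableOn (fun x => cutoff n (f x - g x) * ‖gradient h x‖ ^ p) Ω μ :=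
  integrableOn_cutoff_mul hΩo hK hKΩ hf hg
    ((continuousOn_gradient hΩo hh).norm.rpow_const fun _ _ => Or.inr (by linarith))

theorem integrableOn_cutoff_mul_bregman {n : ℕ} {p : ℝ} (hp : 1 < p) (hΩo : IsOpen Ω)
    (hK : IsCompact (gapSet Ω f g n)) (hKΩ : gapSet Ω f g n ⊆ Ω) (hf : ContDiffOn ℝ 1 f Ω)
    (hg : ContDiffOn ℝ 1 g Ω) :
    IntegrableOn (fun x => cutoff n (f x - g x) * bregman p (gradient f x) (gradient g x)) Ω μ := by
  simp only [cutoff_mul_bregman]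
  exact ((integrableOn_cutoff_mul_norm_rpow hp hΩo hK hKΩ hf.continuousOn hg.continuousOn hg).sub
    (integrableOn_cutoff_mul_norm_rpow hp hΩo hK hKΩ hf.continuousOn hg.continuousOn hf)).sub
    ((integrableOn_cutoff_mul_flux hp hΩo hK hKΩ hf hg).const_mul p)

/-- Testing the weak equation with the truncated gap turns the truncated energy difference into an
integral of the Bregman divergence. -/
theorem integral_cutoff_mul_bregman {n : ℕ} {p : ℝ} (hp : 1 < p) (hΩo : IsOpen Ω)
    (hK : IsCompact (gapSet Ω f g n)) (hKΩ : gapSet Ω f g n ⊆ Ω) (hf : ContDiffOn ℝ 1 f Ω)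
    (hg : ContDiffOn ℝ 1 g Ω)
    (hweak : ∀ η : E → ℝ, ContDiff ℝ 1 η → HasCompactSupport η → tsupport η ⊆ Ω →
      ∫ x in Ω, ‖gradient f x‖ ^ (p - 2) * ⟪gradient f x, gradient η x⟫ ∂μ = 0) :
    ∫ x in Ω, cutoff n (f x - g x) * bregman p (gradient f x) (gradient g x) ∂μ =
      (∫ x in Ω, cutoff n (f x - g x) * ‖gradient g x‖ ^ p ∂μ) -
        ∫ x in Ω, cutoff n (f x - g x) * ‖gradient f x‖ ^ p ∂μ := by
  have hIg := integrableOn_cutoff_mul_norm_rpow (μ := μ) hp hΩo hK hKΩ hf.continuousOn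
    hg.continuousOn hg
  have hIf := integrableOn_cutoff_mul_norm_rpow (μ := μ) hp hΩo hK hKΩ hf.continuousOn
    hg.continuousOn hf
  have hflux : ∫ x in Ω, cutoff n (f x - g x) *
      (‖gradient f x‖ ^ (p - 2) * ⟪gradient f x, gradient g x - gradient f x⟫) ∂μ = 0 := by
    have hsupp := tsupport_truncatedGap_subset hK
    have h := hweak _ (contDiff_truncatedGap hΩo hK hKΩ hf hg)
      (hK.of_isClosed_subset (isClosed_tsupport _) hsupp) (hsupp.trans hKΩ)
    rw [← neg_eq_zero, ← integral_neg, ← h]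
    refine setIntegral_congr_fun hΩo.measurableSet fun x hx => ?_
    simp only [gradient_truncatedGap hΩo (hf.differentiableOn one_ne_zero)
      (hg.differentiableOn one_ne_zero) n hx, inner_smul_right, inner_sub_right]
    ring
  simp only [cutoff_mul_bregman]
  rw [← integral_sub hIg hIf, integral_sub (by exact hIg.sub hIf)
    ((integrableOn_cutoff_mul_flux hp hΩo hK hKΩ hf hg).const_mul p), integral_const_mul, hflux,
    mul_zero, sub_zero]

end Dirichlet

section Energy

variable {E : Type*} [NormedAddCommGroup E] [InnerProductSpace ℝ E] [FiniteDimensional ℝ E]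
  [MeasurableSpace E] [BorelSpace E] {μ : Measure E} [μ.IsAddHaarMeasure] {Ω : Set E} {f g : E → ℝ}

/-- A weak solution of the `p`-Laplace equation has finite energy as soon as its boundary values
have an extension of finite energy. -/
theorem integrableOn_norm_gradient_rpow {p : ℝ} (hp : 1 < p) (hΩo : IsOpen Ω)
    (hK : ∀ n, IsCompact (gapSet Ω f g n)) (hKΩ : ∀ n, gapSet Ω f g n ⊆ Ω)
    (hf : ContDiffOn ℝ 1 f Ω) (hg : ContDiffOn ℝ 1 g Ω)
    (hgE : IntegrableOn (fun x => ‖gradient g x‖ ^ p) Ω μ)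
    (hweak : ∀ η : E → ℝ, ContDiff ℝ 1 η → HasCompactSupport η → tsupport η ⊆ Ω →
      ∫ x in Ω, ‖gradient f x‖ ^ (p - 2) * ⟪gradient f x, gradient η x⟫ ∂μ = 0) :
    IntegrableOn (fun x => ‖gradient f x‖ ^ p) Ω μ := by
  have hcut (n : ℕ) {h : E → ℝ} (hh : ContDiffOn ℝ 1 h Ω) :
      IntegrableOn (fun x => cutoff n (f x - g x) * ‖gradient h x‖ ^ p) Ω μ :=
    integrableOn_cutoff_mul_norm_rpow hp hΩo (hK n) (hKΩ n) hf.continuousOn hg.continuousOn hh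
  have hcut_le (n : ℕ) :
      ∀ x, cutoff n (f x - g x) * ‖gradient g x‖ ^ p ≤ ‖gradient g x‖ ^ p := fun x =>
    mul_le_of_le_one_left (by positivity) (cutoff_le_one _ _)
  refine integrable_of_tendsto_of_integral_le
    (G := fun n x => cutoff n (f x - g x) * ‖gradient f x‖ ^ p +
      (‖gradient g x‖ ^ p - cutoff n (f x - g x) * ‖gradient g x‖ ^ p))
    (C := ∫ x in Ω, ‖gradient g x‖ ^ p ∂μ)
    (fun n => (hcut n hf).add (hgE.sub (hcut n hg))) (fun n => ?_) (fun n => ?_) ?_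
  · refine Eventually.of_forall fun x => ?_
    have h1 := sub_nonneg.2 (hcut_le n x)
    have h2 := cutoff_nonneg n (f x - g x)
    simp only [Pi.zero_apply]
    positivity
  · have hident := integral_cutoff_mul_bregman hp hΩo (hK n) (hKΩ n) hf hg hweak
    have hnonneg : 0 ≤ ∫ x in Ω,
        cutoff n (f x - g x) * bregman p (gradient f x) (gradient g x) ∂μ :=
      integral_nonneg fun x => mul_nonneg (cutoff_nonneg _ _) (bregman_nonneg hp _ _)
    rw [integral_add (hcut n hf) (by exact hgE.sub (hcut n hg)), integral_sub hgE (hcut n hg)]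
    linarith
  · filter_upwards [ae_gradient_eq_of_eq μ hΩo (hf.differentiableOn one_ne_zero)
      (hg.differentiableOn one_ne_zero)] with x hx
    have h := (tendsto_cutoff_mul (f x - g x) (‖gradient f x‖ ^ p - ‖gradient g x‖ ^ p)
      fun h0 => by rw [hx (sub_eq_zero.1 h0), sub_self]).add_const (‖gradient g x‖ ^ p)
    rw [sub_add_cancel] at h
    refine h.congr fun n => ?_
    ring

/-- The truncated energy differences of a weak solution are bounded by the full one. -/
theorem integral_cutoff_mul_bregman_le {p : ℝ} (hp : 1 < p) (hΩo : IsOpen Ω)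
    (hK : ∀ n, IsCompact (gapSet Ω f g n)) (hKΩ : ∀ n, gapSet Ω f g n ⊆ Ω)
    (hf : ContDiffOn ℝ 1 f Ω) (hg : ContDiffOn ℝ 1 g Ω)
    (hgE : IntegrableOn (fun x => ‖gradient g x‖ ^ p) Ω μ)
    (hweak : ∀ η : E → ℝ, ContDiff ℝ 1 η → HasCompactSupport η → tsupport η ⊆ Ω →
      ∫ x in Ω, ‖gradient f x‖ ^ (p - 2) * ⟪gradient f x, gradient η x⟫ ∂μ = 0) (n : ℕ) :
    ∫ x in Ω, cutoff n (f x - g x) * bregman p (gradient f x) (gradient g x) ∂μ ≤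
      (∫ x in Ω, ‖gradient g x‖ ^ p ∂μ) - ∫ x in Ω, ‖gradient f x‖ ^ p ∂μ := by
  have hfE := integrableOn_norm_gradient_rpow hp hΩo hK hKΩ hf hg hgE hweak
  have hcut (m : ℕ) {h : E → ℝ} (hh : ContDiffOn ℝ 1 h Ω) :
      IntegrableOn (fun x => cutoff m (f x - g x) * ‖gradient h x‖ ^ p) Ω μ :=
    integrableOn_cutoff_mul_norm_rpow hp hΩo (hK m) (hKΩ m) hf.continuousOn hg.continuousOn hh
  have hident (m : ℕ) :
      ∫ x in Ω, cutoff m (f x - g x) * bregman p (gradient f x) (gradient g x) ∂μ =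
      ∫ x in Ω, cutoff m (f x - g x) * (‖gradient g x‖ ^ p - ‖gradient f x‖ ^ p) ∂μ := by
    simp only [mul_sub]
    rw [integral_sub (hcut m hg) (hcut m hf)]
    exact integral_cutoff_mul_bregman hp hΩo (hK m) (hKΩ m) hf hg hweak
  have hlim : Tendsto (fun m => ∫ x in Ω,
      cutoff m (f x - g x) * bregman p (gradient f x) (gradient g x) ∂μ) atTop
      (𝓝 ((∫ x in Ω, ‖gradient g x‖ ^ p ∂μ) - ∫ x in Ω, ‖gradient f x‖ ^ p ∂μ)) := by
    simp only [hident]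
    rw [← integral_sub hgE hfE]
    refine tendsto_integral_of_dominated_convergence
      (fun x => ‖‖gradient g x‖ ^ p - ‖gradient f x‖ ^ p‖) (fun m => ?_) (hgE.sub hfE).norm
      (fun m => Eventually.of_forall fun x => ?_) ?_
    · simp only [mul_sub]
      exact ((hcut m hg).sub (hcut m hf)).aestronglyMeasurable
    · rw [norm_mul, Real.norm_of_nonneg (cutoff_nonneg _ _)]
      exact mul_le_of_le_one_left (norm_nonneg _) (cutoff_le_one _ _)
    · filter_upwards [ae_gradient_eq_of_eq μ hΩo (hf.differentiableOn one_ne_zero)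
        (hg.differentiableOn one_ne_zero)] with x hx
      exact tendsto_cutoff_mul _ _ fun h0 => by rw [hx (sub_eq_zero.1 h0), sub_self]
  refine ge_of_tendsto hlim ?_
  filter_upwards [eventually_ge_atTop n] with m hm
  refine integral_mono (integrableOn_cutoff_mul_bregman hp hΩo (hK n) (hKΩ n) hf hg)
    (integrableOn_cutoff_mul_bregman hp hΩo (hK m) (hKΩ m) hf hg) fun x => ?_
  exact mul_le_mul_of_nonneg_right (cutoff_mono _ hm) (bregman_nonneg hp _ _)

theorem eqOn_gradient_of_integral_cutoff_mul_bregman_nonpos {p : ℝ} (hp : 1 < p) (hΩo : IsOpen Ω)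
    (hK : ∀ n, IsCompact (gapSet Ω f g n)) (hKΩ : ∀ n, gapSet Ω f g n ⊆ Ω)
    (hf : ContDiffOn ℝ 1 f Ω) (hg : ContDiffOn ℝ 1 g Ω)
    (hle : ∀ n, ∫ x in Ω,
      cutoff n (f x - g x) * bregman p (gradient f x) (gradient g x) ∂μ ≤ 0) :
    EqOn (gradient f) (gradient g) Ω := by
  have hnonneg (n : ℕ) (x : E) :
      0 ≤ cutoff n (f x - g x) * bregman p (gradient f x) (gradient g x) :=
    mul_nonneg (cutoff_nonneg _ _) (bregman_nonneg hp _ _)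
  have hzero : ∀ᵐ x ∂μ.restrict Ω, ∀ n,
      cutoff n (f x - g x) * bregman p (gradient f x) (gradient g x) = 0 :=
    ae_all_iff.2 fun n => (integral_eq_zero_iff_of_nonneg (hnonneg n)
      (integrableOn_cutoff_mul_bregman hp hΩo (hK n) (hKΩ n) hf hg)).1
      ((hle n).antisymm (integral_nonneg (hnonneg n)))
  refine Measure.eqOn_open_of_ae_eq (μ := μ) ?_ hΩo (continuousOn_gradient hΩo hf)
    (continuousOn_gradient hΩo hg)
  filter_upwards [hzero, ae_gradient_eq_of_eq μ hΩo (hf.differentiableOn one_ne_zero)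
    (hg.differentiableOn one_ne_zero)] with x hx hx'
  by_cases hfg : f x = g x
  · exact hx' hfg
  · obtain ⟨n, hn⟩ := (eventually_cutoff_eq_one (sub_ne_zero.2 hfg)).exists
    have := hx n
    rw [hn, one_mul] at this
    exact eq_of_bregman_eq_zero hp this

end Energy

end PHarmonicEnergy

/-- The `p`-harmonic solution of the Dirichlet problem minimizes the `p`-energy among
all continuous `C¹` extensions of the boundary data, with equality only for the
solution itself. -/
theorem pharmonic_energy_minimality
    (p : ℝ) (hp : 1 < p)
    (Ω : Set (EuclideanSpace ℝ (Fin 2))) (hΩne : Ω.Nonempty)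
    (hΩb : Bornology.IsBounded Ω) (hΩo : IsOpen Ω) (hΩsc : SimplyConnectedSpace Ω)
    (Φ : EuclideanSpace ℝ (Fin 2) → ℝ)
    (hΦc : ContinuousOn Φ (closure Ω)) (hΦd : ContDiffOn ℝ 1 Φ Ω)
    (hΦE : IntegrableOn (fun x => ‖gradient Φ x‖ ^ p) Ω)
    (φ : EuclideanSpace ℝ (Fin 2) → ℝ)
    (hφc : ContinuousOn φ (closure Ω)) (hφp : PHarmonicOn p Ω φ)
    (hbd : EqOn φ Φ (frontier Ω)) :
    (∫ x in Ω, ‖gradient φ x‖ ^ p) ≤ (∫ x in Ω, ‖gradient Φ x‖ ^ p) ∧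
    ((∫ x in Ω, ‖gradient φ x‖ ^ p) = (∫ x in Ω, ‖gradient Φ x‖ ^ p) ↔
      EqOn φ Φ (closure Ω)) := by
  obtain ⟨hφd, hweak⟩ := hφp
  have hK := PHarmonicEnergy.isCompact_gapSet hΩb hφc hΦc
  have hKΩ := PHarmonicEnergy.gapSet_subset hΩo hbd
  have hle := PHarmonicEnergy.integral_cutoff_mul_bregman_le hp hΩo hK hKΩ hφd hΦd hΦE hweak
  refine ⟨?_, fun heq => ?_, fun heq => ?_⟩
  · refine sub_nonneg.1 (le_trans (integral_nonneg fun x => ?_) (hle 0))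
    exact mul_nonneg (PHarmonicEnergy.cutoff_nonneg _ _) (PHarmonicEnergy.bregman_nonneg hp _ _)
  · have hΩc : IsPreconnected Ω := isPreconnected_iff_preconnectedSpace.2 inferInstance
    refine PHarmonicEnergy.eqOn_closure_of_eqOn_gradient hΩne hΩb hΩo hΩc hφc hΦc
      (hφd.differentiableOn one_ne_zero) (hΦd.differentiableOn one_ne_zero) ?_ hbd
    refine PHarmonicEnergy.eqOn_gradient_of_integral_cutoff_mul_bregman_nonpos (μ := volume) hp hΩo
      hK hKΩ hφd hΦd fun n => ?_
    simpa only [heq, sub_self] using hle n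
  · refine setIntegral_congr_fun hΩo.measurableSet fun x hx => ?_
    have hev : φ =ᶠ[𝓝 x] Φ := by
      filter_upwards [hΩo.mem_nhds hx] with y hy using heq (subset_closure hy)
    simp only [PHarmonicEnergy.gradient_eq_iff_fderiv_eq.2 hev.fderiv_eq]
end
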